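/- Let χ₁ and χ₂ be distinct real non-principal primitive Dirichlet characters of conductors q₁ and q₂ with 3 ≤ q₁ < q₂. Suppose β₁ and β₂ are real numbers with L(β₁,χ₁) = 0, L(β₂,χ₂) = 0, β₁ > 1 − 1/(6.3970 · log q₁) and β₂ > 1 − 1/(6.3970 · log q₂). Then q₂ ≥ q₁^{2.1278}. -/

import Mathlib

set_option autoImplicit false

open scoped Real

open Complex

section

open MeasureTheory ProbabilityTheory Set Filter Topology

open scoped ENNReal

/-- `f` is given on `c < re s` by the absolutely convergent two-sided Laplace transform
`∫ exp (s * u) dν(u)` of the positive measure `ν`. -/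
structure IsLaplaceTransform (f : ℂ → ℂ) (ν : Measure ℝ) (c : ℝ) : Prop where
  sfinite : SFinite ν
  integrable : ∀ s : ℝ, c < s → Integrable (fun u : ℝ ↦ Real.exp (s * u)) ν
  eq : ∀ s : ℂ, c < s.re → f s = ∫ u : ℝ, cexp (s * u) ∂ν

lemma integrable_cexp_of_re {ν : Measure ℝ} {s : ℂ}
    (h : Integrable (fun u : ℝ ↦ Real.exp (s.re * u)) ν) :
    Integrable (fun u : ℝ ↦ cexp (s * u)) ν := by
  refine (integrable_norm_iff (by fun_prop)).mp ?_
  simpa [Complex.norm_exp] using h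

namespace IsLaplaceTransform

variable {f g : ℂ → ℂ} {μ ν : Measure ℝ} {c d : ℝ}

lemma mul (hf : IsLaplaceTransform f ν c) (hg : IsLaplaceTransform g μ c) :
    IsLaplaceTransform (fun s ↦ f s * g s) (ν ∗ μ) c := by
  have := hf.sfinite
  have := hg.sfinite
  refine ⟨inferInstance, fun s hs ↦ ?_, fun s hs ↦ ?_⟩
  · rw [Measure.conv, integrable_map_measure (by fun_prop) (by fun_prop)]
    simpa [Function.comp_def, mul_add, Real.exp_add] using
      (hf.integrable s hs).mul_prod (hg.integrable s hs)
  · rw [hf.eq s hs, hg.eq s hs, Measure.conv, integral_map (by fun_prop) (by fun_prop),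
      ← integral_prod_mul]
    simp [mul_add, Complex.exp_add]

lemma mono (hf : IsLaplaceTransform f ν c) (h : c ≤ d) : IsLaplaceTransform f ν d :=
  ⟨hf.sfinite, fun s hs ↦ hf.integrable s (h.trans_lt hs), fun s hs ↦ hf.eq s (h.trans_lt hs)⟩

lemma congr (hf : IsLaplaceTransform f ν c) (h : ∀ s : ℂ, c < s.re → f s = g s) :
    IsLaplaceTransform g ν c :=
  ⟨hf.sfinite, hf.integrable, fun s hs ↦ (h s hs).symm.trans (hf.eq s hs)⟩

end IsLaplaceTransform

lemma isLaplaceTransform_exp (a c : ℝ) :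
    IsLaplaceTransform (fun s ↦ cexp (s * a)) (Measure.dirac a) c :=
  ⟨inferInstance, fun s _ ↦ integrable_dirac (by simp), fun s _ ↦ by simp⟩

/-- The measure on the real line whose Laplace transform is `s ↦ Gammaℝ (s + b)`. -/
noncomputable def gammaMeasureLog (b : ℝ) : Measure ℝ :=
  ((volume.restrict (Ioi 0)).withDensity
    (fun x ↦ ENNReal.ofReal (Real.exp (-x) * x⁻¹ * (x / π) ^ (b / 2)))).map
    (fun x ↦ Real.log (x / π) / 2)

lemma exp_mul_log_eq {x : ℝ} (hx : 0 < x) (b : ℝ) (s : ℂ) :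
    (Real.exp (-x) * x⁻¹ * (x / π) ^ (b / 2) : ℝ) • cexp (s * (Real.log (x / π) / 2 : ℝ)) =
      (π : ℂ) ^ (-(s + b) / 2) * ((Real.exp (-x) : ℝ) * (x : ℂ) ^ ((s + b) / 2 - 1)) := by
  have hπ : (π : ℂ) ≠ 0 := by exact_mod_cast Real.pi_ne_zero
  have hx' : (x : ℂ) ≠ 0 := by exact_mod_cast hx.ne'
  rw [Real.log_div hx.ne' Real.pi_ne_zero, Real.rpow_def_of_pos (by positivity),
    Real.log_div hx.ne' Real.pi_ne_zero, cpow_def_of_ne_zero hπ, cpow_def_of_ne_zero hx',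
    ← Complex.ofReal_log hx.le, ← Complex.ofReal_log Real.pi_pos.le, Complex.real_smul,
    ← Real.exp_log hx, ← Real.exp_neg, Real.log_exp]
  push_cast
  simp only [← Complex.exp_add]
  congr 1
  ring

lemma isLaplaceTransform_Gammaℝ (b : ℝ) :
    IsLaplaceTransform (fun s ↦ Gammaℝ (s + b)) (gammaMeasureLog b) (-b) := by
  have hm : Measurable fun x : ℝ ↦ Real.log (x / π) / 2 := by fun_prop
  have hd : Measurable fun x : ℝ ↦ ENNReal.ofReal (Real.exp (-x) * x⁻¹ * (x / π) ^ (b / 2)) := by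
    fun_prop
  have key : ∀ s : ℂ, -b < s.re →
      Integrable (fun u : ℝ ↦ cexp (s * u)) (gammaMeasureLog b) ∧
      ∫ u : ℝ, cexp (s * u) ∂(gammaMeasureLog b) = Gammaℝ (s + b) := by
    intro s hs
    have hs' : 0 < ((s + b) / 2).re := by simp; linarith
    have hae : ∀ x ∈ Ioi (0 : ℝ),
        (ENNReal.ofReal (Real.exp (-x) * x⁻¹ * (x / π) ^ (b / 2))).toReal •
          cexp (s * (Real.log (x / π) / 2 : ℝ)) =
        (π : ℂ) ^ (-(s + b) / 2) * ((Real.exp (-x) : ℝ) * (x : ℂ) ^ ((s + b) / 2 - 1)) := by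
      intro x hx
      have hx : 0 < x := hx
      rw [ENNReal.toReal_ofReal (by positivity), exp_mul_log_eq hx]
    constructor
    · rw [gammaMeasureLog, integrable_map_measure (by fun_prop) (by fun_prop),
        integrable_withDensity_iff_integrable_smul' hd (by simp)]
      refine IntegrableOn.congr_fun ?_ (fun x hx ↦ (hae x hx).symm) measurableSet_Ioi
      exact (Complex.GammaIntegral_convergent hs').const_mul _
    · rw [gammaMeasureLog, integral_map (by fun_prop) (by fun_prop),
        integral_withDensity_eq_integral_toReal_smul hd (by simp),
        setIntegral_congr_fun measurableSet_Ioi hae, integral_const_mul, Gammaℝ_def,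
        Gamma_eq_integral hs', GammaIntegral]
  refine ⟨?_, fun s hs ↦ ?_, fun s hs ↦ (key s hs).2.symm⟩
  · unfold gammaMeasureLog; infer_instance
  · have := (key s (by simpa using hs)).1.norm
    simpa [Complex.norm_exp] using this

instance nullSingletonClass_gammaMeasureLog (b : ℝ) :
    NullSingletonClass (gammaMeasureLog b) := by
  refine ⟨fun y ↦ ?_⟩
  rw [gammaMeasureLog, Measure.map_apply (by fun_prop) (measurableSet_singleton y)]
  refine (withDensity_absolutelyContinuous _ _) ?_
  rw [Measure.restrict_apply' measurableSet_Ioi]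
  refine Set.Subsingleton.measure_zero ?_ _
  rintro x ⟨hx, hx0⟩ z ⟨hz, hz0⟩
  have hx0 : 0 < x := hx0
  have hz0 : 0 < z := hz0
  simp only [mem_preimage, mem_singleton_iff] at hx hz
  have h := Real.log_injOn_pos (mem_Ioi.2 (by positivity)) (mem_Ioi.2 (by positivity))
    (by linarith : Real.log (x / π) = Real.log (z / π))
  exact (div_left_inj' Real.pi_ne_zero).1 h

lemma conv_singleton_eq_zero (μ ν : Measure ℝ) [SFinite ν] [SFinite μ] [NullSingletonClass μ]
    (x : ℝ) : (μ ∗ ν) {x} = 0 := by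
  rw [Measure.conv_comm, Measure.conv, Measure.map_apply (by fun_prop) (measurableSet_singleton x),
    Measure.measure_prod_null (measurable_add (measurableSet_singleton x))]
  refine Eventually.of_forall fun v ↦ ?_
  refine Set.Subsingleton.measure_zero ?_ _
  rintro a ha b hb
  simp only [mem_preimage, mem_singleton_iff] at ha hb
  linarith

/-- The discrete measure whose Laplace transform is the Dirichlet series with coefficients `a`. -/
noncomputable def dirichletMeasure (a : ℕ → ℝ) : Measure ℝ :=
  Measure.sum fun n : ℕ ↦ ENNReal.ofReal (if n = 0 then 0 else a n) •
    Measure.dirac (-Real.log n)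

lemma isLaplaceTransform_LSeries {a : ℕ → ℝ} (ha : ∀ n, 0 ≤ a n) {c : ℝ}
    (hsum : ∀ s : ℂ, c < s.re → LSeriesSummable (fun n ↦ (a n : ℂ)) s) :
    IsLaplaceTransform (LSeries fun n ↦ (a n : ℂ)) (dirichletMeasure a) c := by
  have hterm : ∀ (s : ℂ) (n : ℕ), ∫ u : ℝ, cexp (s * u)
      ∂(ENNReal.ofReal (if n = 0 then 0 else a n) • Measure.dirac (-Real.log n)) =
      LSeries.term (fun n ↦ (a n : ℂ)) s n := by
    intro s n
    rcases eq_or_ne n 0 with rfl | hn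
    · simp
    · rw [integral_smul_measure, integral_dirac, if_neg hn, ENNReal.toReal_ofReal (ha n),
        LSeries.term_of_ne_zero hn, Complex.real_smul, div_eq_mul_inv, ← Complex.cpow_neg,
        Complex.cpow_def_of_ne_zero (by exact_mod_cast hn), ← Complex.natCast_log]
      push_cast
      ring_nf
  have hint : ∀ s : ℂ, c < s.re →
      Integrable (fun u : ℝ ↦ cexp (s * u)) (dirichletMeasure a) := by
    intro s hs
    refine integrable_sum_measure (fun n ↦ (integrable_dirac (by simp)).smul_measure
      ENNReal.ofReal_ne_top) ?_
    refine (hsum s hs).norm.congr fun n ↦ ?_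
    rw [← hterm]
    simp only [integral_smul_measure, integral_dirac, norm_smul, smul_eq_mul]
    simp
  refine ⟨?_, fun s hs ↦ ?_, fun s hs ↦ ?_⟩
  · unfold dirichletMeasure; infer_instance
  · have := (hint s (by simpa using hs)).norm
    simpa [Complex.norm_exp] using this
  · have h := hint s hs
    rw [dirichletMeasure] at h ⊢
    rw [← (hasSum_integral_measure h).tsum_eq]
    simp_rw [hterm]
    rfl

/-- `f` is bounded on every closed vertical strip of finite width. -/
def BoundedOnStrips (f : ℂ → ℂ) : Prop :=
  ∀ a b : ℝ, ∃ C : ℝ, ∀ s : ℂ, a ≤ s.re → s.re ≤ b → ‖f s‖ ≤ C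

namespace BoundedOnStrips

variable {f g : ℂ → ℂ}

lemma const (c : ℂ) : BoundedOnStrips fun _ ↦ c := fun _ _ ↦ ⟨‖c‖, fun _ _ _ ↦ le_rfl⟩

lemma add (hf : BoundedOnStrips f) (hg : BoundedOnStrips g) :
    BoundedOnStrips fun s ↦ f s + g s := by
  intro a b
  obtain ⟨C, hC⟩ := hf a b
  obtain ⟨C', hC'⟩ := hg a b
  exact ⟨C + C', fun s h₁ h₂ ↦ norm_add_le_of_le (hC s h₁ h₂) (hC' s h₁ h₂)⟩

lemma mul (hf : BoundedOnStrips f) (hg : BoundedOnStrips g) :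
    BoundedOnStrips fun s ↦ f s * g s := by
  intro a b
  obtain ⟨C, hC⟩ := hf a b
  obtain ⟨C', hC'⟩ := hg a b
  exact ⟨C * C', fun s h₁ h₂ ↦ norm_mul_le_of_le (hC s h₁ h₂) (hC' s h₁ h₂)⟩

lemma sub (hf : BoundedOnStrips f) (hg : BoundedOnStrips g) :
    BoundedOnStrips fun s ↦ f s - g s := by
  simpa [sub_eq_add_neg] using hf.add ((const (-1)).mul hg)

lemma sum {ι : Type*} (t : Finset ι) {F : ι → ℂ → ℂ} (hF : ∀ i ∈ t, BoundedOnStrips (F i)) :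
    BoundedOnStrips fun s ↦ ∑ i ∈ t, F i s := by
  classical
  induction t using Finset.induction_on with
  | empty => simpa using const 0
  | insert i t hi ih =>
    simp_rw [Finset.sum_insert hi]
    exact (hF i (Finset.mem_insert_self i t)).add
      (ih fun j hj ↦ hF j (Finset.mem_insert_of_mem hj))

lemma exp_mul (c : ℝ) : BoundedOnStrips fun s ↦ cexp (s * c) := by
  intro a b
  refine ⟨Real.exp (a * c) + Real.exp (b * c), fun s h₁ h₂ ↦ ?_⟩
  rw [Complex.norm_exp, re_mul_ofReal]
  rcases le_total 0 c with hc | hc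
  · exact (Real.exp_le_exp.2 (mul_le_mul_of_nonneg_right h₂ hc)).trans
      (le_add_of_nonneg_left (Real.exp_pos _).le)
  · exact (Real.exp_le_exp.2 (mul_le_mul_of_nonpos_right h₁ hc)).trans
      (le_add_of_nonneg_right (Real.exp_pos _).le)

/-- Precomposition with an affine map with real coefficients and positive slope. -/
lemma comp_affine (hf : BoundedOnStrips f) {m : ℝ} (hm : 0 ≤ m) (c : ℝ) :
    BoundedOnStrips fun s ↦ f (m * s + c) := by
  intro a b
  obtain ⟨C, hC⟩ := hf (m * a + c) (m * b + c)
  refine ⟨C, fun s h₁ h₂ ↦ hC _ ?_ ?_⟩ <;> simp <;> gcongr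

lemma comp_one_sub (hf : BoundedOnStrips f) : BoundedOnStrips fun s ↦ f (1 - s) := by
  intro a b
  obtain ⟨C, hC⟩ := hf (1 - b) (1 - a)
  exact ⟨C, fun s h₁ h₂ ↦ hC _ (by simp; linarith) (by simp; linarith)⟩

lemma dslope (hf : BoundedOnStrips f) (hd : Differentiable ℂ f) (z : ℂ) :
    BoundedOnStrips (dslope f z) := by
  intro a b
  obtain ⟨C, hC⟩ := hf a b
  have hcont : Continuous (_root_.dslope f z) :=
    continuous_iff_continuousAt.2 fun s ↦ by
      rcases eq_or_ne s z with rfl | hs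
      · exact continuousAt_dslope_same.2 (hd s)
      · exact (continuousAt_dslope_of_ne hs).2 (hd s).continuousAt
  obtain ⟨C', hC'⟩ := (isCompact_closedBall z 1).exists_bound_of_continuousOn hcont.continuousOn
  refine ⟨max (C + ‖f z‖) C', fun s h₁ h₂ ↦ ?_⟩
  by_cases hs : s ∈ Metric.closedBall z 1
  · exact (hC' s hs).trans (le_max_right _ _)
  · have h1 : 1 < ‖s - z‖ := by simpa [dist_eq_norm] using hs
    have hne : s ≠ z := by rintro rfl; simp at h1; linarith
    rw [dslope_of_ne f hne, slope_def_module, norm_smul, norm_inv]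
    refine le_trans ?_ (le_max_left _ _)
    calc ‖s - z‖⁻¹ * ‖f s - f z‖ ≤ 1 * ‖f s - f z‖ := by
          gcongr
          exact inv_le_one_of_one_le₀ h1.le
      _ ≤ C + ‖f z‖ := by
          rw [one_mul]
          exact (norm_sub_le _ _).trans (by gcongr; exact hC s h₁ h₂)

end BoundedOnStrips

lemma boundedOnStrips_mellin {f : ℝ → ℂ} (hf : ∀ s : ℂ, MellinConvergent f s) :
    BoundedOnStrips (mellin f) := by
  intro a b
  have ha := (hf a).norm
  have hb := (hf b).norm
  refine ⟨∫ t in Ioi (0 : ℝ), (‖(t : ℂ) ^ ((a : ℂ) - 1) • f t‖ + ‖(t : ℂ) ^ ((b : ℂ) - 1) • f t‖),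
    fun s h₁ h₂ ↦ ?_⟩
  refine norm_integral_le_of_norm_le (ha.add hb) ?_
  refine (ae_restrict_iff' measurableSet_Ioi).2 (Eventually.of_forall fun t ht ↦ ?_)
  have ht : 0 < t := ht
  simp only [norm_smul, Complex.norm_cpow_eq_rpow_re_of_pos ht, sub_re, ofReal_re, one_re]
  rw [← add_mul]
  gcongr
  rcases le_total 1 t with h | h
  · exact (Real.rpow_le_rpow_of_exponent_le h (by linarith)).trans
      (le_add_of_nonneg_left (by positivity))
  · exact (Real.rpow_le_rpow_of_exponent_ge ht h (by linarith)).trans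
      (le_add_of_nonneg_right (by positivity))

lemma WeakFEPair.boundedOnStrips_Λ₀ (P : WeakFEPair ℂ) : BoundedOnStrips P.Λ₀ :=
  boundedOnStrips_mellin fun s ↦ (P.isStrongFEPair_toStrongFEPair.hasMellin s).1

lemma IsStrongFEPair.boundedOnStrips_Λ {P : WeakFEPair ℂ} (hP : IsStrongFEPair P) :
    BoundedOnStrips P.Λ := by
  have : P.Λ = mellin P.f := funext fun s ↦ (hP.hasMellin s).2.symm
  rw [this]
  exact boundedOnStrips_mellin fun s ↦ (hP.hasMellin s).1

lemma boundedOnStrips_completedHurwitzZetaEven₀ (a : UnitAddCircle) :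
    BoundedOnStrips (HurwitzZeta.completedHurwitzZetaEven₀ a) := by
  have := ((BoundedOnStrips.const (1 / 2)).mul
    ((HurwitzZeta.hurwitzEvenFEPair a).boundedOnStrips_Λ₀.comp_affine (m := 1 / 2) (by norm_num) 0))
  convert this using 2 with s
  rw [HurwitzZeta.completedHurwitzZetaEven₀]
  push_cast
  ring_nf

lemma boundedOnStrips_completedHurwitzZetaOdd (a : UnitAddCircle) :
    BoundedOnStrips (HurwitzZeta.completedHurwitzZetaOdd a) := by
  have := ((BoundedOnStrips.const (1 / 2)).mul
    ((HurwitzZeta.isStrong_hurwitzOddFEPair a).boundedOnStrips_Λ.comp_affine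
      (m := 1 / 2) (by norm_num) (1 / 2)))
  convert this using 2 with s
  rw [HurwitzZeta.completedHurwitzZetaOdd]
  push_cast
  ring_nf

lemma boundedOnStrips_completedRiemannZeta₀ : BoundedOnStrips completedRiemannZeta₀ :=
  boundedOnStrips_completedHurwitzZetaEven₀ 0

lemma DirichletCharacter.boundedOnStrips_completedLFunction {N : ℕ} [NeZero N]
    {χ : DirichletCharacter ℂ N} (hχ : χ ≠ 1) : BoundedOnStrips χ.completedLFunction := by
  have hsum : ∑ j, χ j = 0 := χ.sum_eq_zero_of_ne_one hχ
  have hzero : χ 0 = 0 := χ.map_zero' fun h ↦ hχ (χ.level_one' h)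
  have heq : χ.completedLFunction = ZMod.completedLFunction₀ χ := by
    funext s
    rw [DirichletCharacter.completedLFunction, ZMod.completedLFunction_eq, hsum, hzero]
    simp
  have hN : BoundedOnStrips fun s : ℂ ↦ (N : ℂ) ^ (-s) := by
    convert BoundedOnStrips.exp_mul (-Real.log N) using 2 with s
    rw [cpow_def_of_ne_zero (NeZero.ne _), ← natCast_log]
    push_cast
    ring_nf
  rw [heq]
  exact (hN.mul (.sum _ fun j _ ↦ (BoundedOnStrips.const _).mul
    (boundedOnStrips_completedHurwitzZetaEven₀ _))).add
    (hN.mul (.sum _ fun j _ ↦ (BoundedOnStrips.const _).mul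
    (boundedOnStrips_completedHurwitzZetaOdd _)))

lemma integrable_exp_mul_restrict_Ici {ν : Measure ℝ} {c : ℝ}
    (h : ∀ s : ℝ, c < s → Integrable (fun u : ℝ ↦ Real.exp (s * u)) ν) (t : ℝ) :
    Integrable (fun u : ℝ ↦ Real.exp (t * u)) (ν.restrict (Ici 0)) := by
  refine Integrable.mono' (h (max t (c + 1)) (by simp)).integrableOn (by fun_prop) ?_
  refine (ae_restrict_iff' measurableSet_Ici).2 (Eventually.of_forall fun u hu ↦ ?_)
  rw [Real.norm_eq_abs, abs_of_pos (Real.exp_pos _)]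
  exact Real.exp_le_exp.2 (mul_le_mul_of_nonneg_right (le_max_left _ _) hu)

section Entire

variable {μ : Measure ℝ}

lemma integrableExpSet_eq_univ (h : ∀ t : ℝ, Integrable (fun u : ℝ ↦ Real.exp (t * u)) μ) :
    integrableExpSet id μ = univ := eq_univ_of_forall h

lemma differentiable_complexMGF_id (h : ∀ t : ℝ, Integrable (fun u : ℝ ↦ Real.exp (t * u)) μ) :
    Differentiable ℂ (complexMGF id μ) := fun z ↦
  (hasDerivAt_complexMGF (by simp [integrableExpSet_eq_univ h])).differentiableAt

lemma boundedOnStrips_complexMGF_id (h : ∀ t : ℝ, Integrable (fun u : ℝ ↦ Real.exp (t * u)) μ) :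
    BoundedOnStrips (complexMGF id μ) := by
  intro a b
  refine ⟨∫ u, (Real.exp (a * u) + Real.exp (b * u)) ∂μ, fun s h₁ h₂ ↦ ?_⟩
  refine norm_integral_le_of_norm_le ((h a).add (h b)) (Eventually.of_forall fun u ↦ ?_)
  rw [Complex.norm_exp, re_mul_ofReal, id_eq]
  rcases le_total 0 u with hu | hu
  · exact (Real.exp_le_exp.2 (mul_le_mul_of_nonneg_right h₂ hu)).trans
      (le_add_of_nonneg_left (Real.exp_pos _).le)
  · exact (Real.exp_le_exp.2 (mul_le_mul_of_nonpos_right h₁ hu)).trans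
      (le_add_of_nonneg_right (Real.exp_pos _).le)

end Entire

lemma norm_complexMGF_le_of_support_nonpos {μ : Measure ℝ} {t : ℝ}
    (ht : Integrable (fun u : ℝ ↦ Real.exp (t * u)) μ) (hμ : ∀ᵐ u ∂μ, u ≤ 0) {s : ℂ}
    (hs : t ≤ s.re) : ‖complexMGF id μ s‖ ≤ ∫ u, Real.exp (t * u) ∂μ := by
  refine norm_integral_le_of_norm_le ht ?_
  filter_upwards [hμ] with u hu
  rw [Complex.norm_exp, re_mul_ofReal, id_eq]
  exact Real.exp_le_exp.2 (mul_le_mul_of_nonpos_right hs hu)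

lemma norm_complexMGF_le_of_support_nonneg {μ : Measure ℝ} {t : ℝ}
    (ht : Integrable (fun u : ℝ ↦ Real.exp (t * u)) μ) (hμ : ∀ᵐ u ∂μ, 0 ≤ u) {s : ℂ}
    (hs : s.re ≤ t) : ‖complexMGF id μ s‖ ≤ ∫ u, Real.exp (t * u) ∂μ := by
  refine norm_integral_le_of_norm_le ht ?_
  filter_upwards [hμ] with u hu
  rw [Complex.norm_exp, re_mul_ofReal, id_eq]
  exact Real.exp_le_exp.2 (mul_le_mul_of_nonneg_right hs hu)

lemma tendsto_complexMGF_atTop_of_support_neg {μ : Measure ℝ} {t : ℝ}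
    (ht : Integrable (fun u : ℝ ↦ Real.exp (t * u)) μ) (hμ : ∀ᵐ u ∂μ, u < 0) :
    Tendsto (fun x : ℝ ↦ complexMGF id μ x) atTop (𝓝 0) := by
  have := tendsto_integral_filter_of_dominated_convergence (l := atTop) (μ := μ)
    (F := fun (x : ℝ) (u : ℝ) ↦ cexp ((x : ℂ) * (u : ℝ))) (f := fun _ ↦ (0 : ℂ))
    (fun u : ℝ ↦ Real.exp (t * u)) (Eventually.of_forall fun x ↦ by fun_prop) ?_ ht ?_
  · simpa [complexMGF] using this
  · filter_upwards [eventually_ge_atTop t] with x hx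
    filter_upwards [hμ] with u hu
    rw [Complex.norm_exp, re_mul_ofReal, ofReal_re]
    exact Real.exp_le_exp.2 (mul_le_mul_of_nonpos_right hx hu.le)
  · filter_upwards [hμ] with u hu
    rw [tendsto_zero_iff_norm_tendsto_zero]
    simp only [Complex.norm_exp, re_mul_ofReal, ofReal_re]
    exact Real.tendsto_exp_atBot.comp (tendsto_id.atTop_mul_const_of_neg hu)

lemma tendsto_complexMGF_atBot_of_support_pos {μ : Measure ℝ} {t : ℝ}
    (ht : Integrable (fun u : ℝ ↦ Real.exp (t * u)) μ) (hμ : ∀ᵐ u ∂μ, 0 < u) :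
    Tendsto (fun x : ℝ ↦ complexMGF id μ x) atBot (𝓝 0) := by
  have := tendsto_integral_filter_of_dominated_convergence (l := atBot) (μ := μ)
    (F := fun (x : ℝ) (u : ℝ) ↦ cexp ((x : ℂ) * (u : ℝ))) (f := fun _ ↦ (0 : ℂ))
    (fun u : ℝ ↦ Real.exp (t * u)) (Eventually.of_forall fun x ↦ by fun_prop) ?_ ht ?_
  · simpa [complexMGF] using this
  · filter_upwards [eventually_le_atBot t] with x hx
    filter_upwards [hμ] with u hu
    rw [Complex.norm_exp, re_mul_ofReal, ofReal_re]
    exact Real.exp_le_exp.2 (mul_le_mul_of_nonneg_right hx hu.le)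
  · filter_upwards [hμ] with u hu
    rw [tendsto_zero_iff_norm_tendsto_zero]
    simp only [Complex.norm_exp, re_mul_ofReal, ofReal_re]
    exact Real.tendsto_exp_atBot.comp (tendsto_id.atBot_mul_const hu)

/-- An entire function with `H (1 - s) = W * H s` which is bounded on vertical strips, bounded on a
right half-plane and tends to `0` along the positive real axis vanishes identically. -/
lemma eq_zero_of_boundedOnStrips {H : ℂ → ℂ} (hd : Differentiable ℂ H) (hb : BoundedOnStrips H)
    {W : ℂ} (hfe : ∀ s : ℂ, s ≠ 0 → s ≠ 1 → H (1 - s) = W * H s) {C : ℝ}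
    (hC : ∀ s : ℂ, 2 ≤ s.re → ‖H s‖ ≤ C)
    (hlim : Tendsto (fun x : ℝ ↦ H x) atTop (𝓝 0)) (s : ℂ) : H s = 0 := by
  obtain ⟨B, hB⟩ := hb (-1) 2
  have hbdd : Bornology.IsBounded (range H) := by
    refine isBounded_iff_forall_norm_le.2 ⟨max B (max C (‖W‖ * C)), ?_⟩
    rintro _ ⟨z, rfl⟩
    rcases le_total 2 z.re with h2 | h2
    · exact (hC z h2).trans ((le_max_left _ _).trans (le_max_right _ _))
    rcases le_total (-1) z.re with h1 | h1
    · exact (hB z h1 h2).trans (le_max_left _ _)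
    · have hre : 2 ≤ (1 - z).re := by simp; linarith
      have h := hfe (1 - z) (by rintro h; rw [h] at hre; norm_num at hre)
        (by rintro h; rw [h] at hre; norm_num at hre)
      rw [sub_sub_cancel] at h
      rw [h, norm_mul]
      exact (mul_le_mul_of_nonneg_left (hC _ hre) (norm_nonneg _)).trans
        ((le_max_right _ _).trans (le_max_right _ _))
  have hconst : (fun x : ℝ ↦ H x) = fun _ ↦ H s :=
    funext fun x ↦ hd.apply_eq_apply_of_bounded hbdd x s
  rw [hconst] at hlim
  exact tendsto_nhds_unique tendsto_const_nhds hlim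

/-- The analogue of Hecke's formula: if `E` is entire with `E (1 - s) = W * E s` and the product of
`E` with the completed zeta function is the Laplace transform of `ν`, then this product is
recovered from the part of `ν` on the positive half-line. -/
theorem mul_completedRiemannZeta_eq {E : ℂ → ℂ} {ν : Measure ℝ} {W : ℂ} (hW : W * W = 1)
    (hd : Differentiable ℂ E) (hb : BoundedOnStrips E) (hfe : ∀ s, E (1 - s) = W * E s)
    (hν : IsLaplaceTransform (fun s ↦ E s * completedRiemannZeta s) ν 1) (hν0 : ν {0} = 0)
    {s : ℂ} (hs0 : s ≠ 0) (hs1 : s ≠ 1) :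
    E s * completedRiemannZeta s = complexMGF id (ν.restrict (Ici 0)) s +
      W * complexMGF id (ν.restrict (Ici 0)) (1 - s) + E 1 / (s - 1) - W * E 1 / s := by
  set J := complexMGF id (ν.restrict (Ici 0)) with hJ
  set K := complexMGF id (ν.restrict (Iio 0)) with hK
  have hint := integrable_exp_mul_restrict_Ici hν.integrable
  have hint2 : Integrable (fun u : ℝ ↦ Real.exp (2 * u)) (ν.restrict (Iio 0)) :=
    (hν.integrable 2 (by norm_num)).integrableOn
  have hneg : ∀ᵐ u ∂(ν.restrict (Iio 0)), u < 0 := ae_restrict_mem measurableSet_Iio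
  have hnonneg : ∀ᵐ u ∂(ν.restrict (Ici 0)), 0 ≤ u := ae_restrict_mem measurableSet_Ici
  have hpos : ∀ᵐ u ∂(ν.restrict (Ici 0)), 0 < u := by
    have h1 : ∀ᵐ u ∂ν, u ≠ 0 := measure_eq_zero_iff_ae_notMem.1 hν0
    filter_upwards [hnonneg, ae_restrict_of_ae h1] with u hu hu' using lt_of_le_of_ne hu hu'.symm
  have hJd : Differentiable ℂ J := differentiable_complexMGF_id hint
  have hJb : BoundedOnStrips J := boundedOnStrips_complexMGF_id hint
  have hE0 : E 0 = W * E 1 := by simpa using hfe 1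
  have hdsd : ∀ z, Differentiable ℂ (dslope E z) := fun z ↦ by
    rw [← differentiableOn_univ] at hd ⊢
    exact (Complex.differentiableOn_dslope univ_mem).2 hd
  set H : ℂ → ℂ := fun s ↦ E s * completedRiemannZeta₀ s - dslope E 0 s + dslope E 1 s - J s -
    W * J (1 - s) with hH
  have hds0 : ∀ z : ℂ, z ≠ 0 → dslope E 0 z = (E z - W * E 1) / z := fun z hz ↦ by
    rw [dslope_of_ne _ hz, slope_def_field, hE0, sub_zero]
  have hds1 : ∀ z : ℂ, z ≠ 1 → dslope E 1 z = (E z - E 1) / (z - 1) := fun z hz ↦ by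
    rw [dslope_of_ne _ hz, slope_def_field]
  have hHd : Differentiable ℂ H := by
    have := differentiable_completedZeta₀
    have := hdsd 0
    have := hdsd 1
    fun_prop
  have hHb : BoundedOnStrips H :=
    ((((hb.mul boundedOnStrips_completedRiemannZeta₀).sub (hb.dslope hd 0)).add
      (hb.dslope hd 1)).sub hJb).sub ((BoundedOnStrips.const W).mul hJb.comp_one_sub)
  have hHfe : ∀ z : ℂ, z ≠ 0 → z ≠ 1 → H (1 - z) = W * H z := by
    intro z hz0 hz1
    have hz1' : 1 - z ≠ 0 := sub_ne_zero.2 (Ne.symm hz1)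
    have hz1'' : z - 1 ≠ 0 := sub_ne_zero.2 hz1
    have hz0' : 1 - z ≠ 1 := by simpa using hz0
    simp only [hH]
    rw [hds0 _ hz1', hds0 _ hz0, hds1 _ hz1, hds1 _ hz0', hfe, completedRiemannZeta₀_one_sub,
      sub_sub_cancel, show (1 : ℂ) - z - 1 = -z by ring]
    field_simp
    linear_combination ((1 - z) ^ 2 * (E 1 - z * J (1 - z))) * hW
  have hHeq : ∀ z : ℂ, z ≠ 0 → z ≠ 1 → H z = E z * completedRiemannZeta z -
      (J z + W * J (1 - z) + E 1 / (z - 1) - W * E 1 / z) := by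
    intro z hz0 hz1
    have hz1' : 1 - z ≠ 0 := sub_ne_zero.2 (Ne.symm hz1)
    have hz1'' : z - 1 ≠ 0 := sub_ne_zero.2 hz1
    simp only [hH]
    rw [hds0 _ hz0, hds1 _ hz1, completedRiemannZeta_eq, show 1 - z = -(z - 1) by ring]
    field_simp
    ring
  have hHK : ∀ z : ℂ, 2 ≤ z.re → H z = K z - (W * J (1 - z) + E 1 / (z - 1) - W * E 1 / z) := by
    intro z hz
    have hsplit : E z * completedRiemannZeta z = J z + K z := by
      rw [hν.eq z (by linarith), hJ, hK, complexMGF, complexMGF]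
      have := integral_add_compl measurableSet_Ici
        (integrable_cexp_of_re (hν.integrable z.re (by linarith))) (s := Ici (0 : ℝ))
      rw [compl_Ici] at this
      exact this.symm
    rw [hHeq z (by rintro rfl; norm_num at hz) (by rintro rfl; norm_num at hz), hsplit]
    ring
  have hHC : ∀ z : ℂ, 2 ≤ z.re → ‖H z‖ ≤ (∫ u, Real.exp (2 * u) ∂(ν.restrict (Iio 0))) +
      (‖W‖ * (∫ u, Real.exp (0 * u) ∂(ν.restrict (Ici 0))) + ‖E 1‖ + ‖W * E 1‖) := by
    intro z hz
    have hn0 : 1 ≤ ‖z‖ := (by linarith : 1 ≤ z.re).trans (Complex.re_le_norm z)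
    have hn1 : 1 ≤ ‖z - 1‖ := (by simp; linarith : 1 ≤ (z - 1).re).trans (Complex.re_le_norm _)
    rw [hHK z hz]
    refine norm_sub_le_of_le (norm_complexMGF_le_of_support_nonpos hint2
      (hneg.mono fun _ h ↦ h.le) hz) (norm_sub_le_of_le (norm_add_le_of_le ?_ ?_) ?_)
    · rw [norm_mul]
      gcongr
      exact norm_complexMGF_le_of_support_nonneg (hint 0) hnonneg (by simp; linarith)
    · rw [norm_div]; exact div_le_self (norm_nonneg _) hn1
    · rw [norm_div]; exact div_le_self (norm_nonneg _) hn0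
  have hHlim : Tendsto (fun x : ℝ ↦ H x) atTop (𝓝 0) := by
    have h1 : Tendsto (fun x : ℝ ↦ (1 - x : ℝ)) atTop atBot :=
      tendsto_const_nhds.add_atBot tendsto_neg_atTop_atBot
    have hJlim := (tendsto_complexMGF_atBot_of_support_pos (hint 0) hpos).comp h1
    have hKlim := tendsto_complexMGF_atTop_of_support_neg hint2 hneg
    have h2 : Tendsto (fun x : ℝ ↦ (x : ℂ)⁻¹) atTop (𝓝 0) := by
      have := (continuous_ofReal.tendsto 0).comp tendsto_inv_atTop_zero
      simpa [Function.comp_def] using this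
    have h3 : Tendsto (fun x : ℝ ↦ ((x : ℂ) - 1)⁻¹) atTop (𝓝 0) := by
      have := h2.comp (tendsto_atTop_add_const_right atTop (-1) tendsto_id)
      simpa [Function.comp_def, sub_eq_add_neg] using this
    have h4 := hKlim.sub (((hJlim.const_mul W).add (h3.const_mul (E 1))).sub
      (h2.const_mul (W * E 1)))
    simp only [mul_zero, add_zero, sub_zero] at h4
    refine h4.congr' ?_
    filter_upwards [eventually_ge_atTop 2] with x hx
    rw [hHK x (by simpa using hx)]
    simp [div_eq_mul_inv, hJ, hK]
  have := hHeq s hs0 hs1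
  rw [eq_zero_of_boundedOnStrips hHd hHb hHfe hHC hHlim s] at this
  exact (sub_eq_zero.1 this.symm)

/-- The kernel `exp (s * u)`, symmetrised under `s ↦ 1 - s` with sign `W`. -/
noncomputable def symmExp (W s u : ℝ) : ℝ := Real.exp (s * u) + W * Real.exp ((1 - s) * u)

/-- The polar part `1 / (1 - s) + W / s` of a completed function with functional equation of
sign `W`. -/
noncomputable def polarPart (W s : ℝ) : ℝ := 1 / (1 - s) + W / s

section Kernel

variable {W : ℝ}

lemma symmExp_mono (hW : W = 1 ∨ W = -1) {s t u : ℝ} (hs : 1 / 2 ≤ s) (hst : s ≤ t) (hu : 0 ≤ u) :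
    symmExp W s u ≤ symmExp W t u := by
  have key : ∀ x : ℝ, Real.exp (x * u) = Real.exp (u / 2) * Real.exp ((x - 1 / 2) * u) := by
    intro x; rw [← Real.exp_add]; ring_nf
  have h0 : 0 ≤ (s - 1 / 2) * u := mul_nonneg (by linarith) hu
  have h1 : (s - 1 / 2) * u ≤ (t - 1 / 2) * u := by gcongr
  have e1 : ∀ x : ℝ, Real.exp ((1 - x - 1 / 2) * u) = Real.exp (-((x - 1 / 2) * u)) := by
    intro x; ring_nf
  unfold symmExp
  rw [key s, key (1 - s), key t, key (1 - t), e1, e1]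
  rcases hW with rfl | rfl
  · have := Real.cosh_le_cosh.2 (by rwa [abs_of_nonneg h0, abs_of_nonneg (h0.trans h1)] :
      |(s - 1 / 2) * u| ≤ |(t - 1 / 2) * u|)
    rw [Real.cosh_eq, Real.cosh_eq] at this
    nlinarith [Real.exp_pos (u / 2)]
  · have := Real.sinh_le_sinh.2 h1
    rw [Real.sinh_eq, Real.sinh_eq] at this
    nlinarith [Real.exp_pos (u / 2)]

lemma symmExp_nonneg (hW : W = 1 ∨ W = -1)
    {s u : ℝ} (hs : 1 / 2 ≤ s) (hu : 0 ≤ u) : 0 ≤ symmExp W s u := by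
  refine le_trans ?_ (symmExp_mono hW le_rfl hs hu)
  unfold symmExp
  rcases hW with rfl | rfl <;> norm_num
  positivity

lemma symmExp_le (hW : W = 1 ∨ W = -1) {s u : ℝ} (hs : 1 / 2 ≤ s) (hu : 0 ≤ u) :
    symmExp W s u ≤ 2 * Real.exp (s * u) := by
  have h : Real.exp ((1 - s) * u) ≤ Real.exp (s * u) :=
    Real.exp_le_exp.2 (mul_le_mul_of_nonneg_right (by linarith) hu)
  unfold symmExp
  rcases hW with rfl | rfl
  · linarith
  · linarith [Real.exp_pos ((1 - s) * u), Real.exp_pos (s * u)]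

lemma symmExp_three_mul_sub_one (hW : W = 1 ∨ W = -1) (s u : ℝ) :
    symmExp W (3 * s - 1) u = (2 * Real.cosh ((2 * s - 1) * u) - W) * symmExp W s u := by
  have h1 : Real.exp ((3 * s - 1) * u) = Real.exp ((2 * s - 1) * u) * Real.exp (s * u) := by
    rw [← Real.exp_add]; ring_nf
  have h2 : Real.exp ((1 - (3 * s - 1)) * u) =
      Real.exp (-((2 * s - 1) * u)) * Real.exp ((1 - s) * u) := by
    rw [← Real.exp_add]; ring_nf
  have h3 : Real.exp ((1 - s) * u) = Real.exp (-((2 * s - 1) * u)) * Real.exp (s * u) := by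
    rw [← Real.exp_add]; ring_nf
  have h4 : Real.exp ((2 * s - 1) * u) * Real.exp (-((2 * s - 1) * u)) = 1 := by
    rw [← Real.exp_add]; simp
  have hW2 : W ^ 2 = 1 := by rcases hW with rfl | rfl <;> norm_num
  unfold symmExp
  rw [h1, h2, h3, Real.cosh_eq]
  set X := Real.exp ((2 * s - 1) * u)
  set Y := Real.exp (-((2 * s - 1) * u))
  linear_combination (Real.exp (s * u) * Y) * hW2 - W * Real.exp (s * u) * h4

lemma sq_exp_mul_symmExp_le (hW : W = 1 ∨ W = -1)
    {s T u : ℝ} (hs : 1 / 2 ≤ s) (hT : 0 ≤ T) (hu : 0 ≤ u) :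
    (2 * Real.cosh ((2 * s - 1) * T) - W) * ((Real.exp (2 * (u - T)) - 1) * symmExp W s u) ≤
      (Real.exp (2 * (u - T)) - 1) * symmExp W (3 * s - 1) u := by
  rw [symmExp_three_mul_sub_one hW]
  have hw := symmExp_nonneg hW hs hu
  have hs' : 0 ≤ 2 * s - 1 := by linarith
  suffices 0 ≤ (Real.exp (2 * (u - T)) - 1) *
      (Real.cosh ((2 * s - 1) * u) - Real.cosh ((2 * s - 1) * T)) by
    nlinarith [mul_nonneg this hw]
  rcases le_total u T with h | h
  · refine mul_nonneg_of_nonpos_of_nonpos ?_ ?_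
    · have := Real.exp_le_one_iff.2 (by linarith : 2 * (u - T) ≤ 0)
      linarith
    · rw [sub_nonpos, Real.cosh_le_cosh, abs_of_nonneg (by positivity),
        abs_of_nonneg (by positivity)]
      gcongr
  · refine mul_nonneg ?_ ?_
    · have := Real.one_le_exp (by linarith : 0 ≤ 2 * (u - T))
      linarith
    · rw [sub_nonneg, Real.cosh_le_cosh, abs_of_nonneg (by positivity),
        abs_of_nonneg (by positivity)]
      gcongr

lemma polarPart_pos (hW : W = 1 ∨ W = -1)
    {s : ℝ} (hs : 1 / 2 < s) (hs1 : s < 1) : 0 < polarPart W s := by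
  have h : 1 / s < 1 / (1 - s) := one_div_lt_one_div_of_lt (by linarith) (by linarith)
  have h0 : 0 < 1 / s := by positivity
  unfold polarPart
  rcases hW with rfl | rfl
  · linarith
  · rw [neg_div]; linarith

end Kernel

lemma hasDerivAt_polarPart (W : ℝ) {s : ℝ} (hs : s ≠ 0) (hs1 : s ≠ 1) :
    HasDerivAt (polarPart W) (1 / (1 - s) ^ 2 - W / s ^ 2) s := by
  have h1 : HasDerivAt (fun s : ℝ ↦ 1 / (1 - s)) (1 / (1 - s) ^ 2) s := by
    have := ((hasDerivAt_id' s).const_sub 1).fun_inv (sub_ne_zero.2 hs1.symm)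
    simpa [one_div] using this
  have h2 : HasDerivAt (fun s : ℝ ↦ W / s) (-W / s ^ 2) s := by
    have := (hasDerivAt_inv hs).const_mul W
    simpa [div_eq_mul_inv] using this
  exact (h1.fun_add h2).congr_deriv (by ring)

section Integral

variable {μ : Measure ℝ}

lemma integrable_symmExp (hint : ∀ t : ℝ, Integrable (fun u : ℝ ↦ Real.exp (t * u)) μ)
    (W s : ℝ) : Integrable (symmExp W s) μ :=
  (hint s).add ((hint (1 - s)).const_mul W)

lemma integrable_exp_mul_symmExp (hint : ∀ t : ℝ, Integrable (fun u : ℝ ↦ Real.exp (t * u)) μ)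
    (c W s : ℝ) :
    Integrable (fun u ↦ Real.exp (c * u) * symmExp W s u) μ := by
  have h : (fun u ↦ Real.exp (c * u) * symmExp W s u) =
      fun u ↦ Real.exp ((s + c) * u) + W * Real.exp ((1 - s + c) * u) := by
    funext u
    rw [symmExp, add_mul s, add_mul (1 - s), Real.exp_add, Real.exp_add]
    ring
  rw [h]
  exact (hint _).add ((hint _).const_mul W)

lemma integrable_mul_exp (hint : ∀ t : ℝ, Integrable (fun u : ℝ ↦ Real.exp (t * u)) μ)
    (t : ℝ) : Integrable (fun u : ℝ ↦ u * Real.exp (t * u)) μ := by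
  have := integrable_pow_mul_exp_of_mem_interior_integrableExpSet (X := id) (μ := μ) (v := t)
    (by simp [integrableExpSet_eq_univ hint]) 1
  simpa using this

lemma integrable_mul_symmExp (hint : ∀ t : ℝ, Integrable (fun u : ℝ ↦ Real.exp (t * u)) μ)
    (W s : ℝ) : Integrable (fun u ↦ u * symmExp W s u) μ := by
  have := (integrable_mul_exp hint s).add ((integrable_mul_exp hint (1 - s)).const_mul W)
  refine this.congr (Eventually.of_forall fun u ↦ ?_)
  simp only [symmExp, Pi.add_apply]
  ring

lemma hasDerivAt_integral_symmExp (hint : ∀ t : ℝ, Integrable (fun u : ℝ ↦ Real.exp (t * u)) μ)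
    (W s : ℝ) :
    HasDerivAt (fun s ↦ ∫ u, symmExp W s u ∂μ)
      (∫ u, u * (Real.exp (s * u) - W * Real.exp ((1 - s) * u)) ∂μ) s := by
  have hd : ∀ t : ℝ, HasDerivAt (mgf id μ) (∫ u, u * Real.exp (t * u) ∂μ) t := fun t ↦
    hasDerivAt_mgf (X := id) (by simp [integrableExpSet_eq_univ hint])
  have h1 := (hd s).add (((hd (1 - s)).comp s ((hasDerivAt_id s).const_sub 1)).const_mul W)
  have h2 : (fun s ↦ ∫ u, symmExp W s u ∂μ) =
      mgf id μ + fun s ↦ W * (mgf id μ ∘ fun x ↦ 1 - id x) s := by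
    funext t
    simp only [symmExp, Pi.add_apply, mgf, Function.comp, id]
    rw [integral_add (hint t) ((hint _).const_mul W), integral_const_mul]
  rw [h2]
  refine h1.congr_deriv ?_
  rw [mul_neg_one, mul_neg, ← integral_const_mul, ← sub_eq_add_neg,
    ← integral_sub (integrable_mul_exp hint _) ((integrable_mul_exp hint _).const_mul W)]
  congr 1 with u
  ring

variable {W : ℝ}

/-- Two zeros (or a double zero) of `∫ symmExp W s - a * polarPart W s` produce a critical point
of the quotient of the two terms. -/
lemma exists_deriv_mul_eq (hint : ∀ t : ℝ, Integrable (fun u : ℝ ↦ Real.exp (t * u)) μ)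
    {β β' a : ℝ} (hβ : 1 / 2 < β) (hβ' : β' < 1) (hle : β ≤ β')
    (hW : W = 1 ∨ W = -1)
    (h1 : ∫ u, symmExp W β u ∂μ = a * polarPart W β)
    (h2 : ∫ u, symmExp W β' u ∂μ = a * polarPart W β')
    (h3 : β = β' → HasDerivAt (fun s ↦ ∫ u, symmExp W s u ∂μ - a * polarPart W s) 0 β) :
    ∃ s, β ≤ s ∧ s ≤ β' ∧
      (∫ u, u * (Real.exp (s * u) - W * Real.exp ((1 - s) * u)) ∂μ) * polarPart W s =
      (∫ u, symmExp W s u ∂μ) * (1 / (1 - s) ^ 2 - W / s ^ 2) := by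
  have hd : ∀ s, β ≤ s → s ≤ β' →
      HasDerivAt (polarPart W) (1 / (1 - s) ^ 2 - W / s ^ 2) s := fun s hs hs' ↦
    hasDerivAt_polarPart W (by linarith) (by linarith)
  have hpos : ∀ s, β ≤ s → s ≤ β' → 0 < polarPart W s := fun s hs hs' ↦
    polarPart_pos hW (by linarith) (by linarith)
  rcases hle.eq_or_lt with heq | hlt
  · refine ⟨β, le_rfl, hle, ?_⟩
    have h4 := (hasDerivAt_integral_symmExp hint W β).sub ((hd β le_rfl hle).const_mul a)
    have h5 := h4.unique (h3 heq)
    rw [h1]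
    linear_combination polarPart W β * h5
  · have hdq : ∀ s, β ≤ s → s ≤ β' → HasDerivAt (fun s ↦ (∫ u, symmExp W s u ∂μ) / polarPart W s)
        (((∫ u, u * (Real.exp (s * u) - W * Real.exp ((1 - s) * u)) ∂μ) * polarPart W s -
        (∫ u, symmExp W s u ∂μ) * (1 / (1 - s) ^ 2 - W / s ^ 2)) / polarPart W s ^ 2) s :=
      fun s hs hs' ↦ (hasDerivAt_integral_symmExp hint W s).div (hd s hs hs') (hpos s hs hs').ne'
    obtain ⟨s, hs, h⟩ := exists_hasDerivAt_eq_zero hlt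
      (fun s hs ↦ (hdq s hs.1 hs.2).continuousAt.continuousWithinAt)
      (by rw [h1, h2, mul_div_cancel_right₀ _ (hpos β le_rfl hle).ne',
        mul_div_cancel_right₀ _ (hpos β' hle le_rfl).ne'])
      (fun s hs ↦ hdq s hs.1.le hs.2.le)
    refine ⟨s, hs.1.le, hs.2.le, ?_⟩
    have hne := pow_ne_zero 2 (hpos s hs.1.le hs.2.le).ne'
    exact sub_eq_zero.1 ((div_eq_zero_iff.1 h).resolve_right hne)

lemma integral_sub_mul_symmExp_nonneg (hint : ∀ t : ℝ, Integrable (fun u : ℝ ↦ Real.exp (t * u)) μ)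
    (hW : W = 1 ∨ W = -1) (hμ : ∀ᵐ u ∂μ, 0 ≤ u)
    {s : ℝ} (hs : 1 / 2 < s) (hs1 : s < 1)
    (h : (∫ u, u * (Real.exp (s * u) - W * Real.exp ((1 - s) * u)) ∂μ) * polarPart W s =
      (∫ u, symmExp W s u ∂μ) * (1 / (1 - s) ^ 2 - W / s ^ 2)) :
    0 ≤ ∫ u, (u - (1 / (1 - s) - 1 / s)) * symmExp W s u ∂μ := by
  have hs0 : s ≠ 0 := by linarith
  have hs1' : 1 - s ≠ 0 := by linarith
  have h2s : 0 < 2 * s - 1 := by linarith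
  have hintd : Integrable (fun u ↦ u * (Real.exp (s * u) - W * Real.exp ((1 - s) * u))) μ := by
    refine ((integrable_mul_exp hint s).sub ((integrable_mul_exp hint (1 - s)).const_mul W)).congr
      (Eventually.of_forall fun u ↦ ?_)
    simp only [Pi.sub_apply]
    ring
  have hsub : ∫ u, (u - (1 / (1 - s) - 1 / s)) * symmExp W s u ∂μ =
      (∫ u, u * symmExp W s u ∂μ) - (1 / (1 - s) - 1 / s) * ∫ u, symmExp W s u ∂μ := by
    rw [← integral_const_mul, ← integral_sub (integrable_mul_symmExp hint W s)
      ((integrable_symmExp hint W s).const_mul _)]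
    congr 1 with u
    ring
  have hb := polarPart_pos hW hs hs1
  rw [hsub]
  set I := ∫ u, symmExp W s u ∂μ
  set K := ∫ u, u * (Real.exp (s * u) - W * Real.exp ((1 - s) * u)) ∂μ
  rcases hW with rfl | rfl
  · have hle : K ≤ ∫ u, u * symmExp 1 s u ∂μ := by
      refine integral_mono_ae hintd (integrable_mul_symmExp hint 1 s) ?_
      filter_upwards [hμ] with u hu
      refine mul_le_mul_of_nonneg_left ?_ hu
      rw [symmExp]
      linarith [Real.exp_pos ((1 - s) * u)]
    have : K = (1 / (1 - s) - 1 / s) * I := by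
      refine mul_right_cancel₀ hb.ne' (h.trans ?_)
      unfold polarPart
      field_simp
      ring
    linarith
  · have hle : K ≤ (∫ u, u * symmExp (-1) s u ∂μ) + 2 / (2 * s - 1) * I := by
      rw [← integral_const_mul, ← integral_add (integrable_mul_symmExp hint _ s)
        ((integrable_symmExp hint _ s).const_mul _)]
      refine integral_mono_ae hintd ((integrable_mul_symmExp hint _ s).add
        ((integrable_symmExp hint _ s).const_mul _)) ?_
      filter_upwards [hμ] with u hu
      have e1 : Real.exp (s * u) = Real.exp ((2 * s - 1) * u) * Real.exp ((1 - s) * u) := by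
        rw [← Real.exp_add]; ring_nf
      have e2 := Real.add_one_le_exp ((2 * s - 1) * u)
      have e3 : 2 * u ≤ 2 / (2 * s - 1) * (Real.exp ((2 * s - 1) * u) - 1) := by
        rw [div_mul_eq_mul_div, le_div_iff₀ h2s]
        linarith
      have e4 := mul_le_mul_of_nonneg_right e3 (Real.exp_pos ((1 - s) * u)).le
      simp only [symmExp]
      rw [e1]
      linarith
    have hpol : polarPart (-1) s = (2 * s - 1) / (s * (1 - s)) := by
      unfold polarPart
      field_simp
      ring
    have hpol' : 2 / (2 * s - 1) * polarPart (-1) s = 2 / (s * (1 - s)) := by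
      rw [hpol, div_mul_div_cancel₀ h2s.ne']
    have : K = (1 / (1 - s) - 1 / s + 2 / (2 * s - 1)) * I := by
      refine mul_right_cancel₀ hb.ne' (h.trans ?_)
      rw [mul_right_comm, add_mul, hpol', hpol]
      field_simp
      ring
    linarith

lemma integral_symmExp_le (hint : ∀ t : ℝ, Integrable (fun u : ℝ ↦ Real.exp (t * u)) μ)
    (hW : W = 1 ∨ W = -1) (hμ : ∀ᵐ u ∂μ, 0 ≤ u)
    {s T : ℝ} (hs : 1 / 2 ≤ s) (hT : 0 ≤ T)
    (h : 0 ≤ ∫ u, (u - T) * symmExp W s u ∂μ) :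
    ∫ u, symmExp W (3 * s - 1) u ∂μ ≤ 2 * Real.exp (-2 * T) * mgf id μ (3 * s - 1 + 2) := by
  have hg : ∀ t u : ℝ, (Real.exp (2 * (u - T)) - 1) * symmExp W t u =
      Real.exp (-2 * T) * (Real.exp (2 * u) * symmExp W t u) - symmExp W t u := by
    intro t u
    rw [show 2 * (u - T) = -2 * T + 2 * u by ring, Real.exp_add]
    ring
  have hgint : ∀ t, Integrable (fun u ↦ (Real.exp (2 * (u - T)) - 1) * symmExp W t u) μ := by
    intro t
    simp_rw [hg]
    exact ((integrable_exp_mul_symmExp hint 2 W t).const_mul _).sub (integrable_symmExp hint W t)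
  have hsubint : Integrable (fun u ↦ (u - T) * symmExp W s u) μ := by
    simp_rw [sub_mul]
    exact (integrable_mul_symmExp hint W s).sub ((integrable_symmExp hint W s).const_mul T)
  have h1 : 0 ≤ ∫ u, (Real.exp (2 * (u - T)) - 1) * symmExp W s u ∂μ := by
    have := integral_mono_ae (hsubint.const_mul 2) (hgint s) (by
      filter_upwards [hμ] with u hu
      have := Real.add_one_le_exp (2 * (u - T))
      have hw := symmExp_nonneg hW hs hu
      nlinarith)
    rw [integral_const_mul] at this
    linarith
  have h2 : 0 ≤ ∫ u, (Real.exp (2 * (u - T)) - 1) * symmExp W (3 * s - 1) u ∂μ := by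
    have hr : 0 ≤ 2 * Real.cosh ((2 * s - 1) * T) - W := by
      have := Real.one_le_cosh ((2 * s - 1) * T)
      rcases hW with rfl | rfl <;> linarith
    refine (mul_nonneg hr h1).trans ?_
    rw [← integral_const_mul]
    refine integral_mono_ae ((hgint s).const_mul _) (hgint _) ?_
    filter_upwards [hμ] with u hu using sq_exp_mul_symmExp_le hW hs hT hu
  have h3 : ∫ u, Real.exp (2 * u) * symmExp W (3 * s - 1) u ∂μ ≤
      2 * mgf id μ (3 * s - 1 + 2) := by
    rw [mgf, ← integral_const_mul]
    refine integral_mono_ae (integrable_exp_mul_symmExp hint _ _ _) ((hint _).const_mul 2) ?_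
    filter_upwards [hμ] with u hu
    rw [symmExp, add_mul (3 * s - 1), id, Real.exp_add]
    have hle : Real.exp ((1 - (3 * s - 1)) * u) ≤ Real.exp ((3 * s - 1) * u) :=
      Real.exp_le_exp.2 (mul_le_mul_of_nonneg_right (by linarith) hu)
    have p1 := Real.exp_pos ((1 - (3 * s - 1)) * u)
    have p2 := Real.exp_pos (2 * u)
    rcases hW with rfl | rfl <;> nlinarith
  simp_rw [hg] at h2
  rw [integral_sub ((integrable_exp_mul_symmExp hint 2 W _).const_mul _)
    (integrable_symmExp hint W _), integral_const_mul] at h2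
  have := mul_le_mul_of_nonneg_left h3 (Real.exp_pos (-2 * T)).le
  linarith

/-- The repulsion inequality: if `∫ symmExp W s - a * polarPart W s` vanishes at two points close
to `1` (or doubly at one point) and satisfies a growth condition to the right of `1`, then
the zeros cannot be too close to `1`. -/
theorem exp_le_of_two_zeros (hint : ∀ t : ℝ, Integrable (fun u : ℝ ↦ Real.exp (t * u)) μ)
    (hW : W = 1 ∨ W = -1) (hμ : ∀ᵐ u ∂μ, 0 ≤ u)
    (hμ0 : μ ≠ 0) {β β' a D : ℝ} (hβ : 21 / 25 ≤ β) (hβ' : β' < 1)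
    (hle : β ≤ β') (hD : 0 ≤ D)
    (h1 : ∫ u, symmExp W β u ∂μ = a * polarPart W β)
    (h2 : ∫ u, symmExp W β' u ∂μ = a * polarPart W β')
    (h3 : β = β' → HasDerivAt (fun s ↦ ∫ u, symmExp W s u ∂μ - a * polarPart W s) 0 β)
    (h4 : ∀ σ, 1 < σ → σ < 2 →
      mgf id μ (σ + 2) ≤ D * (∫ u, symmExp W σ u ∂μ - a * polarPart W σ)) :
    Real.exp (2 * (1 / (1 - β) - 1 / β)) ≤ 4 * D := by
  obtain ⟨s, hs, hs', heq⟩ := exists_deriv_mul_eq hint (by linarith) hβ' hle hW h1 h2 h3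
  have hTmono : 1 / (1 - β) - 1 / β ≤ 1 / (1 - s) - 1 / s := by
    have e1 : 1 / (1 - β) ≤ 1 / (1 - s) := one_div_le_one_div_of_le (by linarith) (by linarith)
    have e2 : 1 / s ≤ 1 / β := one_div_le_one_div_of_le (by linarith) hs
    linarith
  have hT5 : 5 ≤ 1 / (1 - β) - 1 / β := by
    have e1 : 25 / 4 ≤ 1 / (1 - β) := by
      rw [le_div_iff₀ (by linarith)]; linarith
    have e2 : 1 / β ≤ 5 / 4 := by
      rw [div_le_iff₀ (by linarith)]; linarith
    linarith
  set T := 1 / (1 - s) - 1 / s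
  have hI := integral_symmExp_le hint hW hμ (by linarith) (by linarith)
    (integral_sub_mul_symmExp_nonneg hint hW hμ (by linarith) (by linarith) heq)
  set σ := 3 * s - 1
  have hσ1 : 38 / 25 ≤ σ := by linarith
  have hnn : ∀ t, 1 / 2 ≤ t → 0 ≤ ∫ u, symmExp W t u ∂μ := fun t ht ↦
    integral_nonneg_of_ae (by filter_upwards [hμ] with u hu using symmExp_nonneg hW ht hu)
  have hmono : ∫ u, symmExp W β u ∂μ ≤ ∫ u, symmExp W σ u ∂μ := by
    refine integral_mono_ae (integrable_symmExp hint W _) (integrable_symmExp hint W _) ?_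
    filter_upwards [hμ] with u hu using symmExp_mono hW (by linarith) (by linarith) hu
  have hbβ : 5 ≤ polarPart W β := by
    have e2 : 0 < 1 / β := by positivity
    unfold polarPart
    rcases hW with rfl | rfl
    · linarith
    · rw [neg_div]; linarith
  have ha : 0 ≤ a := by
    have := hnn β (by linarith)
    rw [h1] at this
    exact nonneg_of_mul_nonneg_left this (by linarith)
  have hbσ : -3 ≤ polarPart W σ := by
    have e1 : 1 / (σ - 1) ≤ 2 := by
      rw [div_le_iff₀ (by linarith)]; linarith
    have e2 : 1 / σ ≤ 1 := by
      rw [div_le_iff₀ (by linarith)]; linarith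
    have e3 : 0 < 1 / σ := by positivity
    have e4 : 1 / (1 - σ) = -(1 / (σ - 1)) := by
      rw [← neg_sub σ 1, div_neg]
    unfold polarPart
    rcases hW with rfl | rfl
    · linarith
    · rw [neg_div]; linarith
  have hbound : ∫ u, symmExp W σ u ∂μ - a * polarPart W σ ≤ 2 * ∫ u, symmExp W σ u ∂μ := by
    nlinarith
  have hM := (h4 σ (by linarith) (by linarith)).trans (mul_le_mul_of_nonneg_left hbound hD)
  have hMpos : 0 < mgf id μ (σ + 2) := mgf_pos' hμ0 (hint _)
  have hIpos : 0 < ∫ u, symmExp W σ u ∂μ := by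
    refine lt_of_le_of_ne (hnn σ (by linarith)) fun h ↦ ?_
    rw [← h] at hM
    linarith
  have hfin : (1 : ℝ) ≤ Real.exp (-2 * T) * (4 * D) := by
    have := hI.trans (mul_le_mul_of_nonneg_left hM (by positivity))
    refine le_of_mul_le_mul_right ?_ hIpos
    linarith
  calc Real.exp (2 * (1 / (1 - β) - 1 / β)) ≤ Real.exp (2 * T) := by gcongr
    _ ≤ Real.exp (2 * T) * (Real.exp (-2 * T) * (4 * D)) :=
      le_mul_of_one_le_right (by positivity) hfin
    _ = 4 * D := by
      rw [← mul_assoc, ← Real.exp_add]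
      simp

end Integral

namespace DirichletCharacter

lemma isQuadratic_of_im_eq_zero {N : ℕ} [NeZero N] {χ : DirichletCharacter ℂ N}
    (h : ∀ n, (χ n).im = 0) : χ.IsQuadratic := by
  intro n
  by_cases hn : IsUnit n
  · have h1 : ‖χ n‖ = 1 := by
      obtain ⟨u, rfl⟩ := hn
      exact unit_norm_eq_one χ u
    have h2 : χ n = ((χ n).re : ℂ) := Complex.ext rfl (by simp [h n])
    rw [h2, Complex.norm_real, Real.norm_eq_abs, abs_eq zero_le_one] at h1
    rcases h1 with h1 | h1 <;> rw [h2, h1] <;> simp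
  · exact Or.inl (χ.map_nonunit hn)

variable {q₁ q₂ : ℕ} {χ₁ : DirichletCharacter ℂ q₁} {χ₂ : DirichletCharacter ℂ q₂}

instance neZero_lcm [NeZero q₁] [NeZero q₂] : NeZero (q₁.lcm q₂) :=
  ⟨Nat.lcm_ne_zero (NeZero.ne _) (NeZero.ne _)⟩

instance neZero_conductor {N : ℕ} [NeZero N] (χ : DirichletCharacter ℂ N) : NeZero χ.conductor :=
  ⟨conductor_ne_zero χ⟩

lemma changeLevel_primitive_mul :
    changeLevel (conductor_dvd_level _) (primitive_mul χ₁ χ₂) =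
      changeLevel (Nat.dvd_lcm_left q₁ q₂) χ₁ * changeLevel (Nat.dvd_lcm_right q₁ q₂) χ₂ :=
  changeLevel_primitiveCharacter _

lemma isQuadratic_primitive_mul [NeZero q₁] [NeZero q₂]
    (h₁ : χ₁.IsQuadratic) (h₂ : χ₂.IsQuadratic) : (primitive_mul χ₁ χ₂).IsQuadratic := by
  rw [MulChar.isQuadratic_iff_sq_eq_one]
  apply changeLevel_injective (conductor_dvd_level (mul χ₁ χ₂))
  rw [map_pow, changeLevel_primitive_mul, map_one, mul_pow, ← map_pow, ← map_pow,
    h₁.sq_eq_one, h₂.sq_eq_one, map_one, map_one, one_mul]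

lemma dvd_lcm_conductor_mul_right [NeZero q₁] [NeZero q₂]
    (h₁ : χ₁.IsPrimitive) (h₂ : χ₂.IsPrimitive) : q₂ ∣ q₁.lcm (mul χ₁ χ₂).conductor := by
  have := conductor_mul_dvd_lcm_conductor
    (changeLevel (Nat.dvd_lcm_left q₁ q₂) χ₁)⁻¹ (mul χ₁ χ₂)
  rwa [mul, inv_mul_cancel_left, conductor_changeLevel, conductor_inv, conductor_changeLevel,
    h₁, h₂] at this

lemma dvd_lcm_conductor_mul_left [NeZero q₁] [NeZero q₂]
    (h₁ : χ₁.IsPrimitive) (h₂ : χ₂.IsPrimitive) : q₁ ∣ q₂.lcm (mul χ₁ χ₂).conductor := by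
  have := conductor_mul_dvd_lcm_conductor
    (changeLevel (Nat.dvd_lcm_right q₁ q₂) χ₂)⁻¹ (mul χ₁ χ₂)
  rwa [mul, mul_comm (changeLevel _ χ₁), inv_mul_cancel_left, conductor_changeLevel, conductor_inv,
    conductor_changeLevel, h₁, h₂, mul_comm (changeLevel _ χ₂)] at this

lemma conductor_mul_ne_one [NeZero q₁] [NeZero q₂] (h₁ : χ₁.IsPrimitive) (h₂ : χ₂.IsPrimitive)
    (h : q₁ ≠ q₂) : (mul χ₁ χ₂).conductor ≠ 1 := by
  intro h3
  have hl := dvd_lcm_conductor_mul_left h₁ h₂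
  have hr := dvd_lcm_conductor_mul_right h₁ h₂
  rw [h3, Nat.lcm_one_right] at hl hr
  exact h (Nat.dvd_antisymm hl hr)

lemma natCast_eq_zero_iff {N : ℕ} (χ : DirichletCharacter ℂ N) (n : ℕ) :
    χ (n : ZMod N) = 0 ↔ ¬ n.Coprime N := by
  rw [← Int.cast_natCast, apply_eq_zero_iff, Nat.isCoprime_iff_coprime]

open scoped ComplexOrder in
lemma one_add_add_add_nonneg [NeZero q₁] [NeZero q₂] (h₁ : χ₁.IsQuadratic) (h₂ : χ₂.IsQuadratic)
    (hp₁ : χ₁.IsPrimitive) (hp₂ : χ₂.IsPrimitive) (n : ℕ) :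
    0 ≤ 1 + χ₁ n + χ₂ n + primitive_mul χ₁ χ₂ n := by
  have h₃ := isQuadratic_primitive_mul h₁ h₂
  have key : χ₁ n = 0 ∧ χ₂ n = 0 ∨ χ₁ n = 0 ∧ primitive_mul χ₁ χ₂ n = 0 ∨
      χ₂ n = 0 ∧ primitive_mul χ₁ χ₂ n = 0 ∨ primitive_mul χ₁ χ₂ n = χ₁ n * χ₂ n := by
    by_cases hn : n.Coprime (q₁.lcm q₂)
    · have hc : IsCoprime (n : ℤ) (q₁.lcm q₂ : ℕ) := Nat.isCoprime_iff_coprime.mpr hn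
      have h := DFunLike.congr_fun (changeLevel_primitive_mul (χ₁ := χ₁) (χ₂ := χ₂))
        ((n : ℤ) : ZMod (q₁.lcm q₂))
      rw [MulChar.mul_apply, changeLevel_eq_cast_of_dvd' _ _ hc, changeLevel_eq_cast_of_dvd' _ _ hc,
        changeLevel_eq_cast_of_dvd' _ _ hc, Int.cast_natCast, Int.cast_natCast,
        Int.cast_natCast] at h
      exact Or.inr (Or.inr (Or.inr h))
    · have lcm_of {a b c : ℕ} (ha : n.Coprime a) (hb : n.Coprime b) (hc : c ∣ a.lcm b) :
          n.Coprime c :=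
        ((ha.mul_right hb).coprime_dvd_right (Nat.lcm_dvd_mul a b)).coprime_dvd_right hc
      have e₁ := natCast_eq_zero_iff χ₁ n
      have e₂ := natCast_eq_zero_iff χ₂ n
      have e₃ := natCast_eq_zero_iff (primitive_mul χ₁ χ₂) n
      have a₁ : ¬ (n.Coprime q₁ ∧ n.Coprime q₂) := fun h ↦ hn (lcm_of h.1 h.2 dvd_rfl)
      have a₂ : ¬ (n.Coprime q₁ ∧ n.Coprime (mul χ₁ χ₂).conductor) := fun h ↦
        a₁ ⟨h.1, lcm_of h.1 h.2 (dvd_lcm_conductor_mul_right hp₁ hp₂)⟩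
      have a₃ : ¬ (n.Coprime q₂ ∧ n.Coprime (mul χ₁ χ₂).conductor) := fun h ↦
        a₁ ⟨lcm_of h.1 h.2 (dvd_lcm_conductor_mul_left hp₁ hp₂), h.1⟩
      tauto
  rcases h₁ n with a | a | a <;> rcases h₂ n with b | b | b <;>
    rcases h₃ n with c | c | c <;> rw [a, b, c] at key ⊢ <;> (try norm_num at key) <;> norm_num

end DirichletCharacter

namespace ArithmeticFunction

lemma toArithmeticFunction_apply (f : ℕ → ℂ) (n : ℕ) :
    toArithmeticFunction f n = if n = 0 then 0 else f n := rfl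

lemma mul_mul_log {f g F G : ArithmeticFunction ℂ}
    (hf : ∀ n, f n * Complex.log n = (F * f) n) (hg : ∀ n, g n * Complex.log n = (G * g) n)
    (n : ℕ) : (f * g) n * Complex.log n = ((F + G) * (f * g)) n := by
  have h : (F + G) * (f * g) = F * f * g + f * (G * g) := by ring
  rw [h, add_apply, mul_apply, mul_apply, mul_apply, Finset.sum_mul, ← Finset.sum_add_distrib]
  refine Finset.sum_congr rfl fun p hp ↦ ?_
  have hp' := Nat.mem_divisorsAntidiagonal.mp hp
  have h1 : p.1 ≠ 0 := fun h ↦ hp'.2 (by rw [← hp'.1, h, zero_mul])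
  have h2 : p.2 ≠ 0 := fun h ↦ hp'.2 (by rw [← hp'.1, h, mul_zero])
  rw [← hf, ← hg, ← hp'.1, ← natCast_log, ← natCast_log, ← natCast_log, Nat.cast_mul,
    Real.log_mul (by exact_mod_cast h1) (by exact_mod_cast h2)]
  push_cast
  ring

open scoped ComplexOrder in
lemma nonneg_of_mul_log_eq {f F : ArithmeticFunction ℂ} (h1 : f 1 = 1) (hF : ∀ n, 0 ≤ F n)
    (hF1 : F 1 = 0) (hf : ∀ n, f n * Complex.log n = (F * f) n) (n : ℕ) : 0 ≤ f n := by
  induction n using Nat.strong_induction_on with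
  | _ n ih =>
    rcases Nat.lt_or_ge 1 n with hn | hn
    · have hlog : 0 < Real.log n := Real.log_pos (by exact_mod_cast hn)
      have key : 0 ≤ f n * (Real.log n : ℂ) := by
        rw [natCast_log, hf, mul_apply]
        refine Finset.sum_nonneg fun p hp ↦ ?_
        have hp' := Nat.mem_divisorsAntidiagonal.mp hp
        rcases eq_or_ne p.1 1 with h | h
        · rw [h, hF1, zero_mul]
        · refine mul_nonneg (hF _) (ih _ ?_)
          have h2 : p.2 ≠ 0 := fun h ↦ hp'.2 (by rw [← hp'.1, h, mul_zero])
          have h3 : p.1 ≠ 0 := fun h ↦ hp'.2 (by rw [← hp'.1, h, zero_mul])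
          rw [← hp'.1]
          exact (Nat.lt_mul_iff_one_lt_left (Nat.pos_of_ne_zero h2)).mpr (by omega)
      exact le_of_mul_le_mul_right (by rwa [zero_mul]) (Complex.zero_lt_real.mpr hlog)
    · interval_cases n <;> simp [h1]

end ArithmeticFunction

namespace DirichletCharacter

open ArithmeticFunction LSeries.notation

lemma toArithmeticFunction_mul_log {N : ℕ} (χ : DirichletCharacter ℂ N) (n : ℕ) :
    toArithmeticFunction (χ ·) n * Complex.log n =
      (toArithmeticFunction (fun n ↦ χ n * (Λ n : ℂ)) * toArithmeticFunction (χ ·)) n := by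
  rcases eq_or_ne n 0 with rfl | hn
  · simp
  · rw [← apply_eq_toArithmeticFunction_apply χ hn]
    exact (congrFun (convolution_twist_vonMangoldt χ) n).symm

lemma LSeriesHasSum_toArithmeticFunction {N : ℕ} [NeZero N] (χ : DirichletCharacter ℂ N) {s : ℂ}
    (hs : 1 < s.re) :
    LSeriesHasSum ↗(toArithmeticFunction (χ ·)) s (LFunction χ s) := by
  rw [LFunction_eq_LSeries χ hs,
    LSeries_congr (fun hn ↦ apply_eq_toArithmeticFunction_apply χ hn) s]
  exact ((LSeriesSummable_congr s fun hn ↦ apply_eq_toArithmeticFunction_apply χ hn).mp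
    (LSeriesSummable_of_one_lt_re χ hs)).LSeriesHasSum

open scoped ComplexOrder in
/-- The product `ζ(s) L(s, χ₁) L(s, χ₂) L(s, χ₁χ₂)` for real primitive characters is a Dirichlet
series with non-negative coefficients. -/
theorem exists_nonneg_LSeriesHasSum {q₁ q₂ : ℕ} [NeZero q₁] [NeZero q₂]
    {χ₁ : DirichletCharacter ℂ q₁}
    {χ₂ : DirichletCharacter ℂ q₂} (h₁ : χ₁.IsQuadratic) (h₂ : χ₂.IsQuadratic)
    (hp₁ : χ₁.IsPrimitive) (hp₂ : χ₂.IsPrimitive) :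
    ∃ a : ℕ → ℝ, (∀ n, 0 ≤ a n) ∧ ∀ s : ℂ, 1 < s.re →
      LSeriesHasSum (fun n ↦ (a n : ℂ)) s
        (riemannZeta s *
          (LFunction χ₁ s * LFunction χ₂ s * LFunction (primitive_mul χ₁ χ₂) s)) := by
  let Z : ArithmeticFunction ℂ := toArithmeticFunction ((1 : DirichletCharacter ℂ 1) ·)
  let A₁ : ArithmeticFunction ℂ := toArithmeticFunction (χ₁ ·)
  let A₂ : ArithmeticFunction ℂ := toArithmeticFunction (χ₂ ·)
  let A₃ : ArithmeticFunction ℂ := toArithmeticFunction (primitive_mul χ₁ χ₂ ·)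
  have hA : ∀ n, 0 ≤ (Z * (A₁ * A₂ * A₃)) n := by
    refine nonneg_of_mul_log_eq ?_ ?_ ?_ (mul_mul_log (toArithmeticFunction_mul_log 1)
      (mul_mul_log (mul_mul_log (toArithmeticFunction_mul_log χ₁)
        (toArithmeticFunction_mul_log χ₂)) (toArithmeticFunction_mul_log (primitive_mul χ₁ χ₂))))
    · simp [Z, A₁, A₂, A₃, toArithmeticFunction_apply,
        MulChar.one_apply (isUnit_of_subsingleton (0 : ZMod 1))]
    · intro n
      rcases eq_or_ne n 0 with rfl | hn
      · simp
      have h := mul_nonneg (one_add_add_add_nonneg h₁ h₂ hp₁ hp₂ n)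
        (Complex.zero_le_real.mpr (vonMangoldt_nonneg (n := n)))
      have h1 : (1 : DirichletCharacter ℂ 1) n = 1 := MulChar.one_apply (isUnit_of_subsingleton _)
      simp only [ArithmeticFunction.add_apply, toArithmeticFunction_apply, hn, if_false, h1]
      convert h using 1
      ring
    · simp [toArithmeticFunction_apply]
  refine ⟨fun n ↦ ((Z * (A₁ * A₂ * A₃)) n).re, fun n ↦ (Complex.nonneg_iff.mp (hA n)).1,
    fun s hs ↦ ?_⟩
  have hre : (fun n ↦ (((Z * (A₁ * A₂ * A₃)) n).re : ℂ)) = ↗(Z * (A₁ * A₂ * A₃)) :=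
    funext fun n ↦ Complex.ext rfl (Complex.nonneg_iff.mp (hA n)).2
  rw [hre, ← LFunction_modOne_eq (χ := 1)]
  exact LSeriesHasSum_mul (LSeriesHasSum_toArithmeticFunction 1 hs)
    (LSeriesHasSum_mul (LSeriesHasSum_mul (LSeriesHasSum_toArithmeticFunction χ₁ hs)
      (LSeriesHasSum_toArithmeticFunction χ₂ hs)) (LSeriesHasSum_toArithmeticFunction _ hs))

end DirichletCharacter

section Repulsion

variable {E : ℂ → ℂ} {ν : Measure ℝ} {W : ℝ}

lemma IsLaplaceTransform.eq_ofReal {f : ℂ → ℂ} {c σ : ℝ} (hν : IsLaplaceTransform f ν c)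
    (hσ : c < σ) : f σ = ((∫ u, Real.exp (σ * u) ∂ν : ℝ) : ℂ) := by
  rw [hν.eq σ (by simpa using hσ), ← integral_complex_ofReal]
  simp

lemma mul_completedRiemannZeta_ofReal_eq (hW : W = 1 ∨ W = -1)
    (hd : Differentiable ℂ E) (hb : BoundedOnStrips E) (hfe : ∀ s, E (1 - s) = W * E s)
    (hν : IsLaplaceTransform (fun s ↦ E s * completedRiemannZeta s) ν 1) (hν0 : ν {0} = 0)
    {s : ℝ} (hs0 : s ≠ 0) (hs1 : s ≠ 1) :
    E s * completedRiemannZeta s =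
      (∫ u, symmExp W s u ∂ν.restrict (Ici 0) : ℝ) - E 1 * (polarPart W s : ℝ) := by
  have hWW : (W : ℂ) * W = 1 := by rcases hW with rfl | rfl <;> simp
  have hint := integrable_exp_mul_restrict_Ici hν.integrable
  have hs1' : (1 : ℂ) - s ≠ 0 := by
    rw [← ofReal_one, ← ofReal_sub]; exact_mod_cast sub_ne_zero.mpr hs1.symm
  have hs1'' : (s : ℂ) - 1 ≠ 0 := by rw [← neg_sub]; exact neg_ne_zero.mpr hs1'
  have hs0' : (s : ℂ) ≠ 0 := by exact_mod_cast hs0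
  rw [mul_completedRiemannZeta_eq hWW hd hb hfe hν hν0 hs0' (by exact_mod_cast hs1),
    ← ofReal_one, ← ofReal_sub, complexMGF_ofReal, complexMGF_ofReal]
  have hI : ∫ u, symmExp W s u ∂ν.restrict (Ici 0) =
      mgf id (ν.restrict (Ici 0)) s + W * mgf id (ν.restrict (Ici 0)) (1 - s) := by
    simp only [symmExp, mgf, id]
    rw [integral_add (hint s) ((hint (1 - s)).const_mul W), integral_const_mul]
  rw [hI, polarPart]
  push_cast
  rw [show (s : ℂ) - 1 = -(1 - s) by ring]
  field_simp
  ring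

theorem exp_le_of_two_zeros_mul_completedRiemannZeta (hW : W = 1 ∨ W = -1)
    (hd : Differentiable ℂ E) (hb : BoundedOnStrips E) (hfe : ∀ s, E (1 - s) = W * E s)
    (hν : IsLaplaceTransform (fun s ↦ E s * completedRiemannZeta s) ν 1) (hν0 : ν {0} = 0)
    {D : ℝ} (hD : 0 ≤ D) (hgrow : ∀ σ : ℝ, 1 < σ → σ < 2 →
      ‖E (σ + 2 : ℝ) * completedRiemannZeta (σ + 2 : ℝ)‖ ≤ D * ‖E σ * completedRiemannZeta σ‖)
    {β β' σ₀ : ℝ} (hσ₀ : 1 < σ₀) (hne : E σ₀ * completedRiemannZeta σ₀ ≠ 0)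
    (hβ : 21 / 25 ≤ β) (hβ' : β' < 1) (hle : β ≤ β') (h1 : E β = 0) (h2 : E β' = 0)
    (h3 : β = β' → HasDerivAt E 0 β) :
    Real.exp (2 * (1 / (1 - β) - 1 / β)) ≤ 4 * D := by
  have hint := integrable_exp_mul_restrict_Ici hν.integrable
  set μ := ν.restrict (Ici 0)
  have hpos := polarPart_pos hW (s := β) (by linarith) (by linarith)
  have hecke (s : ℝ) (h0 : s ≠ 0) (h1 : s ≠ 1) :=
    mul_completedRiemannZeta_ofReal_eq hW hd hb hfe hν hν0 h0 h1
  have hE1 : E 1 = ((∫ u, symmExp W β u ∂μ) / polarPart W β : ℝ) := by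
    have h := hecke β (by linarith) (by linarith)
    rw [h1, zero_mul] at h
    rw [ofReal_div, eq_div_iff (by exact_mod_cast hpos.ne')]
    exact (sub_eq_zero.mp h.symm).symm
  set a := (∫ u, symmExp W β u ∂μ) / polarPart W β with ha
  have hG (s : ℝ) (h0 : s ≠ 0) (h1 : s ≠ 1) : E s * completedRiemannZeta s =
      ((∫ u, symmExp W s u ∂μ - a * polarPart W s : ℝ) : ℂ) := by
    rw [hecke s h0 h1, hE1]; push_cast; rfl
  have hGν {σ : ℝ} (hσ : 1 < σ) : ∫ u, symmExp W σ u ∂μ - a * polarPart W σ =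
      ∫ u, Real.exp (σ * u) ∂ν := by
    have := (hG σ (by linarith) hσ.ne').symm.trans (hν.eq_ofReal hσ)
    exact_mod_cast this
  refine exp_le_of_two_zeros hint hW (ae_restrict_mem measurableSet_Ici) ?_ hβ hβ' hle hD
    (a := a) (div_mul_cancel₀ _ hpos.ne').symm ?_ ?_ ?_
  · intro h0
    have ha0 : a = 0 := by rw [ha, h0]; simp
    refine hne ?_
    rw [hG σ₀ (by linarith) hσ₀.ne', h0, ha0]
    simp
  · have h := hG β' (by linarith) hβ'.ne
    rw [h2, zero_mul] at h
    exact sub_eq_zero.mp (by exact_mod_cast h.symm)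
  · intro hββ'
    have hb0 : (β : ℂ) ≠ 0 := by exact_mod_cast (by linarith : β ≠ 0)
    have hb1 : (β : ℂ) ≠ 1 := by exact_mod_cast (by linarith : β ≠ 1)
    have h := ((h3 hββ').mul
      (differentiableAt_completedZeta hb0 hb1).hasDerivAt).real_of_complex
    simp only [h1, zero_mul, add_zero, zero_re] at h
    refine h.congr_of_eventuallyEq ?_
    filter_upwards [eventually_ne_nhds (by linarith : β ≠ 0),
      eventually_ne_nhds (by linarith : β ≠ 1)] with s hs0 hs1
    rw [Pi.mul_apply, hG s hs0 hs1, ofReal_re]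
  · intro σ hσ hσ2
    have hle : mgf id μ (σ + 2) ≤ ∫ u, Real.exp ((σ + 2) * u) ∂ν :=
      integral_mono_measure Measure.restrict_le_self
        (Eventually.of_forall fun u ↦ (Real.exp_pos _).le) (hν.integrable _ (by linarith))
    have hg := hgrow σ hσ hσ2
    have e1 := hν.eq_ofReal (σ := σ) hσ
    have e2 := hν.eq_ofReal (σ := σ + 2) (by linarith)
    rw [e1, e2, norm_real, norm_real,
      Real.norm_of_nonneg (integral_nonneg fun u ↦ (Real.exp_pos _).le),
      Real.norm_of_nonneg (integral_nonneg fun u ↦ (Real.exp_pos _).le)] at hg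
    rw [hGν hσ]
    exact hle.trans hg

end Repulsion

lemma norm_Gammaℝ_add_two_le {s : ℂ} (hs : s ≠ 0) (hs' : ‖s‖ ≤ 2 * π) :
    ‖Gammaℝ (s + 2)‖ ≤ ‖Gammaℝ s‖ := by
  rw [Gammaℝ_add_two hs, norm_div, norm_div, norm_mul, norm_real,
    Real.norm_of_nonneg Real.pi_pos.le,
    Complex.norm_two, div_div, div_le_iff₀ (by positivity)]
  exact mul_le_mul_of_nonneg_left hs' (norm_nonneg _)

namespace DirichletCharacter

variable {N : ℕ} (χ : DirichletCharacter ℂ N)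

lemma exists_isLaplaceTransform_gammaFactor :
    ∃ ν, IsLaplaceTransform (gammaFactor χ) ν 0 := by
  rcases χ.even_or_odd with hχ | hχ
  · refine ⟨_, ((isLaplaceTransform_Gammaℝ 0).mono (by simp)).congr fun s _ ↦ ?_⟩
    rw [hχ.gammaFactor_def]; simp
  · refine ⟨_, ((isLaplaceTransform_Gammaℝ 1).mono (by simp)).congr fun s _ ↦ ?_⟩
    rw [hχ.gammaFactor_def]; simp

lemma gammaFactor_ne_zero {s : ℂ} (hs : 0 < s.re) : gammaFactor χ s ≠ 0 := by
  rcases χ.even_or_odd with hχ | hχ <;> rw [hχ.gammaFactor_def]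
  · exact Gammaℝ_ne_zero_of_re_pos hs
  · exact Gammaℝ_ne_zero_of_re_pos (by simpa using by linarith)

lemma norm_gammaFactor_add_two_le {σ : ℝ} (hσ : 0 < σ) (hσ2 : σ < 2) :
    ‖gammaFactor χ (σ + 2 : ℝ)‖ ≤ ‖gammaFactor χ σ‖ := by
  have hπ := Real.pi_gt_three
  rcases χ.even_or_odd with hχ | hχ <;> rw [hχ.gammaFactor_def, hχ.gammaFactor_def]
  · have := norm_Gammaℝ_add_two_le (s := σ) (by exact_mod_cast hσ.ne')
      (by rw [norm_real, Real.norm_of_nonneg hσ.le]; linarith)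
    simpa using this
  · have := norm_Gammaℝ_add_two_le (s := (σ + 1 : ℝ)) (by exact_mod_cast (by linarith))
      (by rw [norm_real, Real.norm_of_nonneg (by linarith)]; linarith)
    convert this using 3 <;> push_cast <;> ring

variable [NeZero N]

/-- The completed `L`-function `N ^ (s / 2) * completedLFunction χ s`, for which the functional
equation is symmetric. -/
noncomputable def symmLFunction (s : ℂ) : ℂ :=
  cexp (s * (Real.log N / 2 : ℝ)) * completedLFunction χ s

lemma completedLFunction_eq_mul {s : ℂ} (hs : 0 < s.re) :
    completedLFunction χ s = gammaFactor χ s * LFunction χ s := by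
  rw [LFunction_eq_completed_div_gammaFactor χ s (Or.inl fun h ↦ by simp [h] at hs),
    mul_div_cancel₀ _ (gammaFactor_ne_zero χ hs)]

lemma symmLFunction_eq_mul {s : ℂ} (hs : 0 < s.re) :
    symmLFunction χ s =
      cexp (s * (Real.log N / 2 : ℝ)) * (gammaFactor χ s * LFunction χ s) := by
  rw [symmLFunction, completedLFunction_eq_mul χ hs]

variable {χ}

lemma symmLFunction_eq_zero {s : ℂ} (hs : 0 < s.re) (h : LFunction χ s = 0) :
    symmLFunction χ s = 0 := by
  rw [symmLFunction_eq_mul χ hs, h, mul_zero, mul_zero]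

lemma symmLFunction_ne_zero {s : ℂ} (hs : 1 < s.re) : symmLFunction χ s ≠ 0 := by
  have hs0 : 0 < s.re := by linarith
  rw [symmLFunction_eq_mul χ hs0]
  refine mul_ne_zero (Complex.exp_ne_zero _) (mul_ne_zero (gammaFactor_ne_zero χ hs0) ?_)
  exact LFunction_ne_zero_of_one_le_re χ (Or.inr fun h ↦ by simp [h] at hs) hs.le

lemma differentiable_symmLFunction (hχ : χ ≠ 1) : Differentiable ℂ (symmLFunction χ) :=
  (by fun_prop : Differentiable ℂ fun s : ℂ ↦ cexp (s * (Real.log N / 2 : ℝ))).mul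
    (differentiable_completedLFunction hχ)

lemma boundedOnStrips_symmLFunction (hχ : χ ≠ 1) : BoundedOnStrips (symmLFunction χ) :=
  (BoundedOnStrips.exp_mul _).mul (boundedOnStrips_completedLFunction hχ)

lemma exists_symmLFunction_one_sub (hχ : χ.IsPrimitive) (hq : χ.IsQuadratic) :
    ∃ W : ℝ, (W = 1 ∨ W = -1) ∧ ∀ s, symmLFunction χ (1 - s) = W * symmLFunction χ s := by
  have key (s : ℂ) : symmLFunction χ (1 - s) = rootNumber χ * symmLFunction χ s := by
    have h : cexp ((1 - s) * (Real.log N / 2 : ℝ)) * (N : ℂ) ^ (s - 1 / 2) =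
        cexp (s * (Real.log N / 2 : ℝ)) := by
      rw [cpow_def_of_ne_zero (NeZero.ne _), ← Complex.exp_add, ← natCast_log]
      congr 1
      push_cast
      ring
    rw [symmLFunction, hχ.completedLFunction_one_sub, hq.inv, symmLFunction, ← h]
    ring
  have hsq : rootNumber χ * rootNumber χ = 1 := by
    have h2 : symmLFunction χ 2 ≠ 0 := symmLFunction_ne_zero (by simp)
    have h := key (1 - 2)
    rw [key 2, sub_sub_cancel, ← mul_assoc] at h
    exact mul_right_cancel₀ h2 (by rw [one_mul, ← h])
  rcases mul_self_eq_one_iff.mp hsq with h | h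
  · exact ⟨1, Or.inl rfl, fun s ↦ by rw [key, h, ofReal_one]⟩
  · exact ⟨-1, Or.inr rfl, fun s ↦ by rw [key, h, ofReal_neg, ofReal_one]⟩

end DirichletCharacter

lemma norm_LSeries_le_of_nonneg {a : ℕ → ℝ} (ha : ∀ n, 0 ≤ a n) {σ τ : ℝ} (hστ : σ ≤ τ)
    (hs : LSeriesSummable (fun n ↦ (a n : ℂ)) σ) :
    ‖LSeries (fun n ↦ (a n : ℂ)) τ‖ ≤ ‖LSeries (fun n ↦ (a n : ℂ)) σ‖ := by
  have hle := LSeries.norm_term_le_of_re_le_re (fun n ↦ (a n : ℂ))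
    (s := σ) (s' := τ) (by simpa using hστ)
  have hterm (n : ℕ) : LSeries.term (fun n ↦ (a n : ℂ)) σ n =
      (‖LSeries.term (fun n ↦ (a n : ℂ)) σ n‖ : ℂ) :=
    eq_coe_norm_of_nonneg (LSeries.term_nonneg (Complex.zero_le_real.mpr (ha n)) σ)
  have hσ : LSeries (fun n ↦ (a n : ℂ)) σ =
      ((∑' n, ‖LSeries.term (fun n ↦ (a n : ℂ)) σ n‖ : ℝ) : ℂ) := by
    rw [LSeries, ofReal_tsum]
    exact tsum_congr hterm
  rw [hσ, norm_real, Real.norm_of_nonneg (tsum_nonneg fun _ ↦ norm_nonneg _)]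
  exact tsum_of_norm_bounded hs.norm.hasSum hle

namespace DirichletCharacter

theorem exp_le_of_LFunction_eq_zero {q₁ q₂ : ℕ} [NeZero q₁] [NeZero q₂] (hq : q₁ ≠ q₂)
    {χ₁ : DirichletCharacter ℂ q₁} {χ₂ : DirichletCharacter ℂ q₂} (hχ₁ : χ₁ ≠ 1) (hχ₂ : χ₂ ≠ 1)
    (h₁ : χ₁.IsQuadratic) (h₂ : χ₂.IsQuadratic) (hp₁ : χ₁.IsPrimitive) (hp₂ : χ₂.IsPrimitive)
    {β₁ β₂ : ℝ} (hβ₁ : 21 / 25 ≤ β₁) (hβ₂ : 21 / 25 ≤ β₂)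
    (hL₁ : LFunction χ₁ β₁ = 0) (hL₂ : LFunction χ₂ β₂ = 0) :
    Real.exp (2 * (1 / (1 - min β₁ β₂) - 1 / min β₁ β₂)) ≤ 4 * (q₁ * q₂ : ℝ) ^ 2 := by
  obtain ⟨q₃, _, χ₃, hp₃, h₃, hχ₃, hq₃_le, a, ha, haL⟩ :
      ∃ (q₃ : ℕ) (_ : NeZero q₃) (χ₃ : DirichletCharacter ℂ q₃), χ₃.IsPrimitive ∧ χ₃.IsQuadratic ∧
        χ₃ ≠ 1 ∧ q₃ ≤ q₁ * q₂ ∧ ∃ a : ℕ → ℝ, (∀ n, 0 ≤ a n) ∧ ∀ s : ℂ, 1 < s.re →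
          LSeriesHasSum (fun n ↦ (a n : ℂ)) s
            (riemannZeta s * (LFunction χ₁ s * LFunction χ₂ s * LFunction χ₃ s)) :=
    ⟨_, inferInstance, primitive_mul χ₁ χ₂, primitive_mul_isPrimitive χ₁ χ₂,
      isQuadratic_primitive_mul h₁ h₂,
      fun h ↦ conductor_mul_ne_one hp₁ hp₂ hq <|
        (primitive_mul_isPrimitive χ₁ χ₂).symm.trans (eq_one_iff_conductor_eq_one.mp h),
      Nat.le_of_dvd (Nat.mul_pos (NeZero.pos q₁) (NeZero.pos q₂))
        ((conductor_dvd_level (mul χ₁ χ₂)).trans (Nat.lcm_dvd_mul q₁ q₂)),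
      exists_nonneg_LSeriesHasSum h₁ h₂ hp₁ hp₂⟩
  obtain ⟨W₁, hW₁, hfe₁⟩ := exists_symmLFunction_one_sub hp₁ h₁
  obtain ⟨W₂, hW₂, hfe₂⟩ := exists_symmLFunction_one_sub hp₂ h₂
  obtain ⟨W₃, hW₃, hfe₃⟩ := exists_symmLFunction_one_sub hp₃ h₃
  obtain ⟨ν₁, hν₁⟩ := exists_isLaplaceTransform_gammaFactor χ₁
  obtain ⟨ν₂, hν₂⟩ := exists_isLaplaceTransform_gammaFactor χ₂
  obtain ⟨ν₃, hν₃⟩ := exists_isLaplaceTransform_gammaFactor χ₃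
  set E : ℂ → ℂ := fun s ↦ symmLFunction χ₁ s * symmLFunction χ₂ s * symmLFunction χ₃ s with hE
  set c : ℝ := Real.log q₁ / 2 + Real.log q₂ / 2 + Real.log q₃ / 2 with hc
  have hd₁ := differentiable_symmLFunction hχ₁
  have hd₂ := differentiable_symmLFunction hχ₂
  have hd₃ := differentiable_symmLFunction hχ₃
  have hEζ (s : ℂ) (hs : 1 < s.re) : Gammaℝ s * (cexp (s * c) *
      (gammaFactor χ₁ s * gammaFactor χ₂ s * gammaFactor χ₃ s) * LSeries (fun n ↦ (a n : ℂ)) s) =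
      E s * completedRiemannZeta s := by
    have hs0 : 0 < s.re := by linarith
    have hs' : s ≠ 0 := fun h ↦ by simp [h] at hs0
    have hζ : completedRiemannZeta s = Gammaℝ s * riemannZeta s := by
      rw [riemannZeta_def_of_ne_zero hs', mul_div_cancel₀ _ (Gammaℝ_ne_zero_of_re_pos hs0)]
    have hexp : cexp (s * c) = cexp (s * (Real.log q₁ / 2 : ℝ)) * cexp (s * (Real.log q₂ / 2 : ℝ)) *
        cexp (s * (Real.log q₃ / 2 : ℝ)) := by
      rw [← Complex.exp_add, ← Complex.exp_add, hc, ofReal_add, ofReal_add, mul_add, mul_add]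
    rw [(haL s hs).LSeries_eq, hE, hζ, hexp]
    simp only [symmLFunction_eq_mul _ hs0]
    ring
  have hG := (isLaplaceTransform_Gammaℝ 0).mono (d := 1) (by simp)
  have hR := ((isLaplaceTransform_exp c 1).mul (((hν₁.mul hν₂).mul hν₃).mono zero_le_one)).mul
    (isLaplaceTransform_LSeries ha fun s hs ↦ (haL s hs).LSeriesSummable)
  have hν := (hG.mul hR).congr (g := fun s ↦ E s * completedRiemannZeta s) fun s hs ↦ by
    simpa using hEζ s hs
  have := hG.sfinite
  have := hR.sfinite
  have hν0 := conv_singleton_eq_zero (gammaMeasureLog 0)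
    ((Measure.dirac c ∗ (ν₁ ∗ ν₂) ∗ ν₃) ∗ dirichletMeasure a) 0
  have hqe : Real.exp (2 * c) = q₁ * q₂ * q₃ := by
    rw [hc, show 2 * (Real.log q₁ / 2 + Real.log q₂ / 2 + Real.log q₃ / 2) =
      Real.log q₁ + Real.log q₂ + Real.log q₃ by ring, Real.exp_add, Real.exp_add,
      Real.exp_log, Real.exp_log, Real.exp_log] <;> exact_mod_cast Nat.pos_of_ne_zero (NeZero.ne _)
  have hgrow (σ : ℝ) (hσ : 1 < σ) (hσ2 : σ < 2) :
      ‖E (σ + 2 : ℝ) * completedRiemannZeta (σ + 2 : ℝ)‖ ≤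
        (q₁ * q₂ : ℝ) ^ 2 * ‖E σ * completedRiemannZeta σ‖ := by
    have hσ0 : 0 < σ := by linarith
    rw [← hEζ _ (by simpa using by linarith), ← hEζ _ (by simpa using hσ)]
    have e0 : ‖Gammaℝ (σ + 2 : ℝ)‖ ≤ ‖Gammaℝ σ‖ := by
      have hπ := Real.pi_gt_three
      have := norm_Gammaℝ_add_two_le (s := σ) (by exact_mod_cast hσ0.ne')
        (by rw [norm_real, Real.norm_of_nonneg hσ0.le]; linarith)
      simpa using this
    have e1 := norm_gammaFactor_add_two_le χ₁ hσ0 hσ2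
    have e2 := norm_gammaFactor_add_two_le χ₂ hσ0 hσ2
    have e3 := norm_gammaFactor_add_two_le χ₃ hσ0 hσ2
    have e4 : ‖cexp ((σ + 2 : ℝ) * c)‖ ≤ (q₁ * q₂ : ℝ) ^ 2 * ‖cexp (σ * c)‖ := by
      rw [ofReal_add, add_mul, Complex.exp_add, norm_mul, mul_comm, ofReal_ofNat,
        Complex.norm_exp (2 * c)]
      refine mul_le_mul_of_nonneg_right ?_ (norm_nonneg _)
      rw [show ((2 : ℂ) * c).re = 2 * c by simp, hqe, sq]
      gcongr
      exact_mod_cast hq₃_le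
    have e5 := norm_LSeries_le_of_nonneg ha (τ := σ + 2) (by linarith)
      (haL σ (by simpa using hσ)).LSeriesSummable
    simp only [norm_mul]
    calc _ ≤ ‖Gammaℝ σ‖ * ((q₁ * q₂ : ℝ) ^ 2 * ‖cexp (σ * c)‖ *
          (‖gammaFactor χ₁ σ‖ * ‖gammaFactor χ₂ σ‖ * ‖gammaFactor χ₃ σ‖) *
          ‖LSeries (fun n ↦ (a n : ℂ)) σ‖) := by gcongr
      _ = _ := by ring
  have hz₁ : symmLFunction χ₁ β₁ = 0 := symmLFunction_eq_zero (by simpa using by linarith) hL₁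
  have hz₂ : symmLFunction χ₂ β₂ = 0 := symmLFunction_eq_zero (by simpa using by linarith) hL₂
  have lt_one {q : ℕ} [NeZero q] {χ : DirichletCharacter ℂ q} (hχ : χ ≠ 1) {β : ℝ}
      (hL : LFunction χ β = 0) : β < 1 := by
    by_contra! h
    exact LFunction_ne_zero_of_one_le_re χ (Or.inl hχ) (by simpa using h) hL
  have hW : W₁ * W₂ * W₃ = 1 ∨ W₁ * W₂ * W₃ = -1 := by
    rcases hW₁ with rfl | rfl <;> rcases hW₂ with rfl | rfl <;> rcases hW₃ with rfl | rfl <;> simp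
  have hne : E (2 : ℝ) * completedRiemannZeta (2 : ℝ) ≠ 0 := by
    have h2 : 1 < ((2 : ℝ) : ℂ).re := by simp
    refine mul_ne_zero (mul_ne_zero (mul_ne_zero (symmLFunction_ne_zero h2)
      (symmLFunction_ne_zero h2)) (symmLFunction_ne_zero h2)) fun h ↦
      riemannZeta_ne_zero_of_one_lt_re h2 ?_
    rw [riemannZeta_def_of_ne_zero (by simp), h, zero_div]
  have hdouble (h : β₁ = β₂) : HasDerivAt E 0 β₁ := by
    have := ((hd₁ β₁).hasDerivAt.mul (hd₂ β₁).hasDerivAt).mul (hd₃ β₁).hasDerivAt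
    refine this.congr_deriv ?_
    simp [hz₁, show symmLFunction χ₂ β₁ = 0 by rw [h]; exact hz₂]
  have hE₁ : E β₁ = 0 := by simp [hE, hz₁]
  have hE₂ : E β₂ = 0 := by simp [hE, hz₂]
  have main {β β' : ℝ} := exp_le_of_two_zeros_mul_completedRiemannZeta (β := β) (β' := β') hW
    ((hd₁.mul hd₂).mul hd₃)
    (((boundedOnStrips_symmLFunction hχ₁).mul (boundedOnStrips_symmLFunction hχ₂)).mul
      (boundedOnStrips_symmLFunction hχ₃))
    (fun s ↦ by
      simp only [Pi.mul_apply, hfe₁, hfe₂, hfe₃]; push_cast; ring) hν hν0 (by positivity) hgrow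
      one_lt_two hne
  rcases le_total β₁ β₂ with hle | hle
  · rw [min_eq_left hle]
    exact main hβ₁ (lt_one hχ₂ hL₂) hle hE₁ hE₂ hdouble
  · rw [min_eq_right hle]
    exact main hβ₂ (lt_one hχ₁ hL₁) hle hE₂ hE₁ fun h ↦ by rw [h]; exact hdouble h.symm

end DirichletCharacter

end

/-- Two distinct moduli `3 ≤ q₁ < q₂` cannot both carry an exceptional zero unless
`q₂ ≥ q₁ ^ 2.1278`. -/
theorem exceptional_moduli_power_gap (q₁ q₂ : ℕ) (hq₁ : 3 ≤ q₁) (hlt : q₁ < q₂)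
    (χ₁ : DirichletCharacter ℂ q₁) (χ₂ : DirichletCharacter ℂ q₂)
    (hχ₁_nonprincipal : χ₁ ≠ 1) (hχ₂_nonprincipal : χ₂ ≠ 1)
    (hχ₁_real : ∀ n : ZMod q₁, (χ₁ n).im = 0)
    (hχ₂_real : ∀ n : ZMod q₂, (χ₂ n).im = 0)
    (hχ₁_primitive : χ₁.conductor = q₁)
    (hχ₂_primitive : χ₂.conductor = q₂)
    (β₁ β₂ : ℝ)
    (hβ₁ : β₁ > 1 - 1 / (6.3970 * Real.log q₁))
    (hβ₂ : β₂ > 1 - 1 / (6.3970 * Real.log q₂)) :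
    letI : NeZero q₁ := ⟨by omega⟩
    letI : NeZero q₂ := ⟨by omega⟩
    DirichletCharacter.LFunction χ₁ β₁ = 0 →
    DirichletCharacter.LFunction χ₂ β₂ = 0 →
    (q₂ : ℝ) ≥ (q₁ : ℝ) ^ (2.1278 : ℝ) := by
  have : NeZero q₁ := ⟨by omega⟩
  have : NeZero q₂ := ⟨by omega⟩
  intro hL₁ hL₂
  by_contra! h
  have hq₁0 : (0 : ℝ) < q₁ := Nat.cast_pos.mpr (NeZero.pos q₁)
  have hq₂0 : (0 : ℝ) < q₂ := Nat.cast_pos.mpr (NeZero.pos q₂)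
  have hx : 1 ≤ Real.log q₁ := by
    have h3 : (3 : ℝ) ≤ q₁ := by exact_mod_cast hq₁
    rw [Real.le_log_iff_exp_le hq₁0]
    linarith [Real.exp_one_lt_d9]
  have hxy : Real.log q₁ ≤ Real.log q₂ :=
    Real.log_le_log hq₁0 (by exact_mod_cast hlt.le)
  have hy : Real.log q₂ ≤ 2.1278 * Real.log q₁ := by
    rw [← Real.log_rpow hq₁0]
    exact Real.log_le_log hq₂0 h.le
  have hden : 0 < 6.3970 * Real.log q₁ := by positivity
  have hmin : 1 - 1 / (6.3970 * Real.log q₁) < min β₁ β₂ := by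
    refine lt_min hβ₁ (lt_of_le_of_lt ?_ hβ₂)
    gcongr
  have hlow : (21 / 25 : ℝ) ≤ min β₁ β₂ := by
    have : 1 / (6.3970 * Real.log q₁) ≤ 1 / 6.3970 := by
      gcongr
      linarith
    norm_num at this hmin ⊢
    constructor <;> linarith
  have hm1 : min β₁ β₂ < 1 := by
    refine (min_le_left _ _).trans_lt ?_
    by_contra! h
    exact DirichletCharacter.LFunction_ne_zero_of_one_le_re χ₁ (Or.inl hχ₁_nonprincipal)
      (by simpa using h) hL₁
  have key := DirichletCharacter.exp_le_of_LFunction_eq_zero hlt.ne hχ₁_nonprincipal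
    hχ₂_nonprincipal (DirichletCharacter.isQuadratic_of_im_eq_zero hχ₁_real)
    (DirichletCharacter.isQuadratic_of_im_eq_zero hχ₂_real) hχ₁_primitive hχ₂_primitive
    (hlow.trans (min_le_left _ _)) (hlow.trans (min_le_right _ _)) hL₁ hL₂
  have hinv : 6.3970 * Real.log q₁ ≤ 1 / (1 - min β₁ β₂) := by
    rw [le_one_div hden (by linarith)]
    linarith
  have hinv' : 1 / min β₁ β₂ ≤ 25 / 21 := by
    rw [one_div_le (by linarith) (by norm_num)]
    linarith
  have hlog := (Real.le_log_iff_exp_le (by positivity)).mpr key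
  rw [Real.log_mul (by norm_num) (by positivity), Real.log_pow,
    Real.log_mul hq₁0.ne' hq₂0.ne', show (4 : ℝ) = 2 ^ 2 by norm_num, Real.log_pow] at hlog
  push_cast at hlog
  linarith [Real.log_two_lt_d9]
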